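/- Let K be a number field or a function field of characteristic 0, let n ≥ 2, let f ∈ K[X] be a special polynomial of degree at least 2, and let φ = (f,…,f) : (P^1_K)^n → (P^1_K)^n. Let V be a zero-dimensional φ-preperiodic closed subvariety of (P^1_K)^n. Then for every P ∈ (P^1)^n(K) whose forward orbit O_φ(P) does not intersect V(K), for all but finitely many non-archimedean places 𝔭 of K, V(K_𝔭) does not intersect the 𝔭-adic closure of O_φ(P) in (P^1)^n(K_𝔭). -/

import Mathlib

open Polynomial OnePoint

/-- Action of a polynomial on the projective line `P^1(L) = L ∪ {∞}`:
`∞ ↦ ∞` and `a ↦ f(a)`. -/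
def polyEvalP1 {L : Type} [CommRing L] (f : Polynomial L) : OnePoint L → OnePoint L :=
  OnePoint.map fun a => f.eval a

/-- The diagonally split self-map `(f,…,f)` of `(P^1)^n` (coordinatewise action). -/
def splitMap {L : Type} [CommRing L] {ι : Type} (f : Polynomial L)
    (x : ι → OnePoint L) : ι → OnePoint L :=
  fun i => polyEvalP1 f (x i)

/-- The forward orbit of a point under a self-map. -/
def fwdOrbit {X : Type*} (φ : X → X) (P : X) : Set X :=
  Set.range fun k : ℕ => φ^[k] P

/-- Homogeneous coordinates of a point of `P^1(L)`: `a ↦ (a, 1)`, `∞ ↦ (1, 0)`. -/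
def homCoords {L : Type} [CommRing L] (x : OnePoint L) : Fin 2 → L :=
  Option.elim x ![1, 0] (fun a => ![a, 1])

/-- A polynomial in variables `(i, 0), (i, 1)` (`i : ι`) is multihomogeneous if it is
homogeneous in the pair of variables indexed by each `i` separately. -/
def MultiHomog {K : Type} [CommSemiring K] {ι : Type} [DecidableEq ι]
    (p : MvPolynomial (ι × Fin 2) K) : Prop :=
  ∀ i : ι, ∃ d : ℕ,
    p.IsWeightedHomogeneous (fun jk => if jk.1 = i then (1 : ℕ) else 0) d

/-- A closed subvariety of `(P^1_K)^ι`, given by a set of multihomogeneous equations over `K`. -/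
structure ClosedSubvar (K : Type) [CommRing K] (ι : Type) [DecidableEq ι] where
  polys : Set (MvPolynomial (ι × Fin 2) K)
  homog : ∀ p ∈ polys, MultiHomog p

/-- Whether a multihomogeneous polynomial vanishes at a point of `(P^1(L))^ι`. -/
def vanishesAt {K : Type} [CommRing K] {ι : Type} [DecidableEq ι] {L : Type} [CommRing L]
    (φ : K →+* L) (p : MvPolynomial (ι × Fin 2) K) (x : ι → OnePoint L) : Prop :=
  MvPolynomial.eval (fun jk => homCoords (x jk.1) jk.2) (MvPolynomial.map φ p) = 0

/-- The `L`-points of a closed subvariety, for a `K`-algebra `L` via `φ : K →+* L`. -/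
def ClosedSubvar.pts {K : Type} [CommRing K] {ι : Type} [DecidableEq ι]
    (V : ClosedSubvar K ι) {L : Type} [CommRing L] (φ : K →+* L) :
    Set (ι → OnePoint L) :=
  {x | ∀ p ∈ V.polys, vanishesAt φ p x}

/-- A subset of `(P^1(L))^ι` is Zariski closed if it is the common zero set of a family of
multihomogeneous polynomials over `L`. -/
def IsZarClosed {L : Type} [CommRing L] {ι : Type} [DecidableEq ι]
    (S : Set (ι → OnePoint L)) : Prop :=
  ∃ V : ClosedSubvar L ι, S = V.pts (RingHom.id L)

/-- The Zariski closure of a set of points. -/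
def zarClosure {L : Type} [CommRing L] {ι : Type} [DecidableEq ι]
    (S : Set (ι → OnePoint L)) : Set (ι → OnePoint L) :=
  ⋂₀ {Z | IsZarClosed Z ∧ S ⊆ Z}

/-- An irreducible (closed) subvariety of `(P^1(L))^ι`, as a set of points. -/
def IrrSubvar {L : Type} [CommRing L] {ι : Type} [DecidableEq ι]
    (S : Set (ι → OnePoint L)) : Prop :=
  S.Nonempty ∧ IsZarClosed S ∧
    ∀ Z₁ Z₂ : Set (ι → OnePoint L), IsZarClosed Z₁ → IsZarClosed Z₂ →
      S ⊆ Z₁ ∪ Z₂ → S ⊆ Z₁ ∨ S ⊆ Z₂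

/-- The dimension of a (closed) subvariety, as the Krull dimension of the poset of
irreducible closed subsets contained in it. -/
noncomputable def varDim {L : Type} [CommRing L] {ι : Type} [DecidableEq ι]
    (S : Set (ι → OnePoint L)) : WithBot ℕ∞ :=
  Order.krullDim {T : Set (ι → OnePoint L) // IrrSubvar T ∧ T ⊆ S}

/-- `T` is an irreducible component of `S`: a maximal irreducible closed subset of `S`. -/
def IsComponentOf {L : Type} [CommRing L] {ι : Type} [DecidableEq ι]
    (T S : Set (ι → OnePoint L)) : Prop :=
  IrrSubvar T ∧ T ⊆ S ∧ ∀ T', IrrSubvar T' → T ⊆ T' → T' ⊆ S → T' = T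

/-- A hypersurface in `(P^1(L))^n`: a nonempty Zariski closed set all of whose irreducible
components have dimension `n - 1`. -/
def IsHypersurfaceSet {L : Type} [CommRing L] {n : ℕ}
    (S : Set (Fin n → OnePoint L)) : Prop :=
  S.Nonempty ∧ IsZarClosed S ∧
    ∀ T, IsComponentOf T S → varDim T = ((n - 1 : ℕ) : ℕ∞)

/-- A set of points (e.g. a subvariety) is periodic under the split map `(f,…,f)`. -/
def SubvarPeriodic {L : Type} [CommRing L] {ι : Type} (f : Polynomial L)
    (S : Set (ι → OnePoint L)) : Prop :=
  ∃ m : ℕ, 1 ≤ m ∧ (splitMap f)^[m] '' S = S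

/-- A set of points (e.g. a subvariety) is preparation under `(f,…,f)`. -/
def SubvarPreperiodic {L : Type} [CommRing L] {ι : Type} (f : Polynomial L)
    (S : Set (ι → OnePoint L)) : Prop :=
  ∃ k : ℕ, SubvarPeriodic f ((splitMap f)^[k] '' S)

/-- A place of a field `K`, represented by a nontrivial absolute value. -/
structure PlaceK (K : Type) [Field K] where
  v : AbsoluteValue K ℝ
  nontrivial : ∃ x : K, x ≠ 0 ∧ v x ≠ 1

/-- A place is non-archimedean if its absolute value satisfies the ultrametric inequality. -/
def PlaceK.IsNonarch {K : Type} [Field K] (w : PlaceK K) : Prop :=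
  ∀ x y : K, w.v (x + y) ≤ max (w.v x) (w.v y)

/-- Equivalence of places (equality of the associated topologies / unit balls). -/
def PlaceK.Equiv {K : Type} [Field K] (w w' : PlaceK K) : Prop :=
  ∀ x : K, w.v x < 1 ↔ w'.v x < 1

/-- A choice of completion of `K` at a place `w`: a field `carrier` with an absolute value
extending that of `w` through `emb`, which is complete and in which `K` is dense. -/
structure CompletionOf {K : Type} [Field K] (w : PlaceK K) where
  carrier : Type
  [field : Field carrier]
  emb : K →+* carrier
  absv : AbsoluteValue carrier ℝ
  compat : ∀ x : K, absv (emb x) = w.v x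
  complete : ∀ s : ℕ → carrier,
    (∀ ε : ℝ, 0 < ε → ∃ N : ℕ, ∀ m ≥ N, ∀ k ≥ N, absv (s m - s k) < ε) →
    ∃ a : carrier, ∀ ε : ℝ, 0 < ε → ∃ N : ℕ, ∀ m ≥ N, absv (s m - a) < ε
  dense : ∀ a : carrier, ∀ ε : ℝ, 0 < ε → ∃ x : K, absv (a - emb x) < ε

attribute [instance] CompletionOf.field

/-- The chordal metric on `P^1(L)` attached to an absolute value on `L`. -/
noncomputable def p1Dist {L : Type} [Field L] (w : AbsoluteValue L ℝ) :
    OnePoint L → OnePoint L → ℝ :=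
  fun x y =>
    Option.elim x
      (Option.elim y 0 fun b => 1 / max 1 (w b))
      (fun a => Option.elim y (1 / max 1 (w a))
        (fun b => w (a - b) / (max 1 (w a) * max 1 (w b))))

/-- The topology on `P^1(L)` generated by the balls of the chordal metric. -/
noncomputable def p1Top {L : Type} [Field L] (w : AbsoluteValue L ℝ) :
    TopologicalSpace (OnePoint L) :=
  TopologicalSpace.generateFrom
    {U | ∃ (x : OnePoint L) (ε : ℝ), 0 < ε ∧ U = {y | p1Dist w x y < ε}}

/-- The topology on `(P^1(L))^ι` induced by the chordal metric topology on each factor. -/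
noncomputable def pnTop {L : Type} [Field L] (ι : Type) (w : AbsoluteValue L ℝ) :
    TopologicalSpace (ι → OnePoint L) :=
  @Pi.topologicalSpace ι (fun _ => OnePoint L) (fun _ => p1Top w)

/-- The closure of a set of points of `(P^1(L))^ι` in the topology induced by an
absolute value on `L`. -/
noncomputable def adicClosure {L : Type} [Field L] {ι : Type} (w : AbsoluteValue L ℝ)
    (S : Set (ι → OnePoint L)) : Set (ι → OnePoint L) :=
  @closure _ (pnTop ι w) S

/-- Base change of a point of `P^1(K)` along a field embedding. -/
def mapPoint {K L : Type} [Field K] [Field L] (φ : K →+* L) :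
    OnePoint K → OnePoint L :=
  OnePoint.map φ

/-- `K` is a number field, or a function field of characteristic zero over the ground
field `κ` (finitely generated of transcendence degree 1 over `κ`, with `κ` relatively
algebraically closed in `K`). -/
def NumberFieldOrFunctionFieldOver (K : Type) [Field K] (κ : Subfield K) : Prop :=
  NumberField K ∨
    (CharZero K ∧
      (∃ t : K, Transcendental κ t ∧
        FiniteDimensional (IntermediateField.adjoin κ {t}) K) ∧
      (∀ x : K, IsAlgebraic κ x → x ∈ κ))

/-- The places of `K` relevant for the theorems: in the number field case all places are
allowed; in the function field case only places trivial on the ground field `κ`. -/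
def PlaceK.IsPlaceOver {K : Type} [Field K] (κ : Subfield K) (w : PlaceK K) : Prop :=
  NumberField K ∨ (∀ c : K, c ∈ κ → c ≠ 0 → w.v c = 1)

/-- The `m`-th compositional iterate of a polynomial. -/
noncomputable def polIter {F : Type} [CommSemiring F] (f : Polynomial F) : ℕ → Polynomial F
  | 0 => X
  | m + 1 => f.comp (polIter f m)

/-- Two polynomials commute under composition. -/
def PolyCommute {F : Type} [CommSemiring F] (f g : Polynomial F) : Prop :=
  f.comp g = g.comp f

/-- `g` commutes with some iterate `f^m` (`m ≥ 1`) of `f`. -/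
def CommutesWithIterate {F : Type} [CommSemiring F] (f g : Polynomial F) : Prop :=
  ∃ m : ℕ, 1 ≤ m ∧ PolyCommute (polIter f m) g

/-- `c` is the Chebyshev polynomial of degree `d`, characterized by
`c(x + 1/x) = x^d + 1/x^d`. -/
def IsChebyshevPoly {F : Type} [Field F] (d : ℕ) (c : Polynomial F) : Prop :=
  ∀ x : F, x ≠ 0 → c.eval (x + x⁻¹) = x ^ d + (x⁻¹) ^ d

/-- A polynomial over an algebraically closed field (or any field containing the relevant
conjugating data) is special if it is affinely conjugate to `X^d` or to `±C_d`. -/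
def IsSpecialPolyAux {F : Type} [Field F] (f : Polynomial F) : Prop :=
  ∃ (a b : F), a ≠ 0 ∧
    ∃ g : Polynomial F,
      (g = X ^ f.natDegree ∨ IsChebyshevPoly f.natDegree g ∨
        IsChebyshevPoly f.natDegree (-g)) ∧
      (C a * X + C b).comp g = f.comp (C a * X + C b)

/-- A polynomial over `K` is special if it becomes special (conjugate to `X^d` or `±C_d`)
over an algebraic closure of `K`. -/
def IsSpecialPoly {K : Type} [Field K] (f : Polynomial K) : Prop :=
  IsSpecialPolyAux (f.map (algebraMap K (AlgebraicClosure K)))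

/-- A polynomial of degree at least 2 is disintegrated if it is not special. -/
def IsDisintegrated {K : Type} [Field K] (f : Polynomial K) : Prop :=
  2 ≤ f.natDegree ∧ ¬ IsSpecialPoly f

/-- A point of `P^1` is periodic under (the `P^1`-action of) a polynomial. -/
def P1Periodic {L : Type} [CommRing L] (f : Polynomial L) (ζ : OnePoint L) : Prop :=
  ∃ N : ℕ, 1 ≤ N ∧ (OnePoint.map fun a => f.eval a)^[N] ζ = ζ

/-- A point of `P^1` is preperiodic under a polynomial. -/
def P1Preperiodic {L : Type} [CommRing L] (f : Polynomial L) (ζ : OnePoint L) : Prop :=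
  ∃ k : ℕ, P1Periodic f ((OnePoint.map fun a => f.eval a)^[k] ζ)

/-- At the place `w`, the `w`-adic closure of the `(f,…,f)`-orbit of `P` does not meet
`V(K_w)`: for every completion of `K` at `w`, the `w`-adic closure of the orbit in
`(P^1)^n` of the completion is disjoint from the set of points of `V` over the
completion. -/
def OrbitClosureAvoids {K : Type} [Field K] {n : ℕ} (w : PlaceK K)
    (f : Polynomial K) (P : Fin n → OnePoint K) (V : ClosedSubvar K (Fin n)) : Prop :=
  ∀ C : CompletionOf w,
    adicClosure C.absv
        (fwdOrbit (splitMap (f.map C.emb)) fun i => mapPoint C.emb (P i)) ∩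
      V.pts C.emb = ∅

/-- There are infinitely many (pairwise inequivalent) non-archimedean places of `K`
(trivial on the ground field `κ` in the function field case) satisfying `Q`. -/
def InfinitelyManyPlaces (K : Type) [Field K] (κ : Subfield K)
    (Q : PlaceK K → Prop) : Prop :=
  ∃ T : Set (PlaceK K), T.Infinite ∧
    (T.Pairwise fun w w' => ¬ PlaceK.Equiv w w') ∧
    ∀ w ∈ T, w.IsNonarch ∧ w.IsPlaceOver κ ∧ Q w

/-- All but finitely many non-archimedean places of `K` (trivial on the ground field `κ`
in the function field case) satisfy `Q`. -/
def AllButFinitelyManyPlaces (K : Type) [Field K] (κ : Subfield K)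
    (Q : PlaceK K → Prop) : Prop :=
  ∃ T : Set (PlaceK K), T.Finite ∧
    ∀ w : PlaceK K, w.IsNonarch → w.IsPlaceOver κ →
      (∃ w' ∈ T, PlaceK.Equiv w w') ∨ Q w

section Places

variable {K : Type} [Field K]

/-- An element integral over elements of absolute value at most one has absolute value
at most one. -/
theorem AbsoluteValue.le_one_of_isIntegral {L : Type*} [Field L] {v : AbsoluteValue L ℝ}
    (hv : IsNonarchimedean v) {A : Type*} [CommRing A] [Algebra A L]
    (hA : ∀ a : A, v (algebraMap A L a) ≤ 1) {x : L} (hx : IsIntegral A x) : v x ≤ 1 := by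
  obtain ⟨p, hp, hpx⟩ := hx
  by_contra! h
  have h0 : 0 < v x := by linarith
  rw [Polynomial.eval₂_eq_sum_range, Finset.sum_range_succ, hp.coeff_natDegree, map_one,
    one_mul] at hpx
  have hlt : v (x ^ p.natDegree) < v x ^ p.natDegree := by
    rw [← neg_eq_of_add_eq_zero_right hpx, map_neg_eq_map]
    rcases Nat.eq_zero_or_pos p.natDegree with hd | hd
    · rw [hd]; simp
    refine lt_of_le_of_lt ((IsNonarchimedean.apply_sum_le_sup hv
      (Finset.nonempty_range_iff.2 hd.ne')).trans (Finset.sup'_le _ _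
        (a := v x ^ (p.natDegree - 1)) ?_)) (pow_lt_pow_right₀ h (by omega))
    intro i hi
    rw [map_mul, map_pow]
    calc v (algebraMap A L (p.coeff i)) * v x ^ i ≤ 1 * v x ^ i := by
          gcongr; exact hA _
      _ ≤ v x ^ (p.natDegree - 1) := by
          rw [one_mul]
          exact pow_le_pow_right₀ h.le (by have := Finset.mem_range.1 hi; omega)
  simp at hlt

theorem AllButFinitelyManyPlaces.mono {κ : Subfield K} {Q R : PlaceK K → Prop}
    (h : AllButFinitelyManyPlaces K κ Q)
    (hQR : ∀ w : PlaceK K, w.IsNonarch → Q w → R w) : AllButFinitelyManyPlaces K κ R := by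
  obtain ⟨T, hT, h⟩ := h
  exact ⟨T, hT, fun w hw hκ => (h w hw hκ).imp id (hQR w hw)⟩

theorem AllButFinitelyManyPlaces.of_forall {κ : Subfield K} {Q : PlaceK K → Prop}
    (h : ∀ w, Q w) : AllButFinitelyManyPlaces K κ Q :=
  ⟨∅, Set.finite_empty, fun w _ _ => Or.inr (h w)⟩

theorem AllButFinitelyManyPlaces.forall_finset {κ : Subfield K} {ι : Type*} (s : Finset ι)
    {Q : ι → PlaceK K → Prop} (h : ∀ i ∈ s, AllButFinitelyManyPlaces K κ (Q i)) :
    AllButFinitelyManyPlaces K κ fun w => ∀ i ∈ s, Q i w := by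
  choose! T hT h using h
  refine ⟨⋃ i ∈ s, T i, s.finite_toSet.biUnion hT, fun w hw hκ => ?_⟩
  by_cases hc : ∃ i ∈ s, ∃ w' ∈ T i, PlaceK.Equiv w w'
  · obtain ⟨i, hi, w', hw', he⟩ := hc
    exact Or.inl ⟨w', Set.mem_biUnion hi hw', he⟩
  · exact Or.inr fun i hi => (h i hi w hw hκ).resolve_left fun he => hc ⟨i, hi, he⟩

theorem AllButFinitelyManyPlaces.and {κ : Subfield K} {Q R : PlaceK K → Prop}
    (hQ : AllButFinitelyManyPlaces K κ Q) (hR : AllButFinitelyManyPlaces K κ R) :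
    AllButFinitelyManyPlaces K κ fun w => Q w ∧ R w :=
  (AllButFinitelyManyPlaces.forall_finset (Q := fun b : Bool => cond b Q R) Finset.univ
    (by simp [hQ, hR])).mono fun w _ h => ⟨h true (by simp), h false (by simp)⟩

/-- If the conclusion holds up to equivalence and every exceptional place is determined, up to
equivalence, by a label in a finite set, then only finitely many classes are exceptional. -/
theorem AllButFinitelyManyPlaces.of_finite_label {κ : Subfield K} {Q : PlaceK K → Prop}
    {α : Type*} {s : Set α} (hs : s.Finite) (r : PlaceK K → α → Prop)
    (hr : ∀ w : PlaceK K, w.IsNonarch → w.IsPlaceOver κ → ¬ Q w → ∃ a ∈ s, r w a)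
    (heq : ∀ w w' a, r w a → r w' a → PlaceK.Equiv w w') : AllButFinitelyManyPlaces K κ Q := by
  classical
  rcases isEmpty_or_nonempty (PlaceK K) with _ | _
  · exact .of_forall fun w => isEmptyElim w
  have hg : ∀ a, ∃ w, ∀ w', r w' a → r w a := fun a => by
    by_cases h : ∃ w, r w a
    · exact h.imp fun w h _ _ => h
    · exact ⟨Classical.arbitrary _, fun w' h' => (h ⟨w', h'⟩).elim⟩
  choose g hg using hg
  refine ⟨g '' s, hs.image g, fun w hw hκ => ?_⟩
  by_cases hQ : Q w
  · exact .inr hQ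
  · obtain ⟨a, ha, hra⟩ := hr w hw hκ hQ
    exact .inl ⟨g a, ⟨a, ha, rfl⟩, heq _ _ a hra (hg a w hra)⟩

/-- The relation between a place and its center on a ring `B`: the elements of `B` are integral
and the prime is the set of elements of absolute value less than one. -/
def PlaceK.HasCenter {B : Type*} [CommRing B] [Algebra B K] (w : PlaceK K) (I : Ideal B) : Prop :=
  ∀ b : B, w.v (algebraMap B K b) ≤ 1 ∧ (b ∈ I ↔ w.v (algebraMap B K b) < 1)

theorem PlaceK.exists_hasCenter {B : Type*} [CommRing B] [Algebra B K] {w : PlaceK K}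
    (hw : w.IsNonarch) (hB : ∀ b : B, w.v (algebraMap B K b) ≤ 1) :
    ∃ I : Ideal B, I.IsPrime ∧ w.HasCenter I := by
  let I : Ideal B :=
    { carrier := {b | w.v (algebraMap B K b) < 1}
      add_mem' := fun {a b} ha hb => by
        simp only [Set.mem_ofPred_eq, map_add] at *
        exact (hw _ _).trans_lt (max_lt ha hb)
      zero_mem' := by simp
      smul_mem' := fun c x hx => by
        simp only [Set.mem_ofPred_eq, smul_eq_mul, map_mul] at *
        exact mul_lt_one_of_nonneg_of_lt_one_right (hB c) (w.v.nonneg _) hx }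
  refine ⟨I, ⟨?_, ?_⟩, fun b => ⟨hB b, Iff.rfl⟩⟩
  · rw [Ideal.ne_top_iff_one]
    change ¬ (w.v (algebraMap B K 1) < 1)
    simp
  · intro x y hxy
    change w.v (algebraMap B K (x * y)) < 1 at hxy
    change w.v (algebraMap B K x) < 1 ∨ w.v (algebraMap B K y) < 1
    rw [map_mul, map_mul] at hxy
    by_contra! h
    have h1 := le_antisymm (hB x) h.1
    have h2 := le_antisymm (hB y) h.2
    rw [h1, h2] at hxy
    norm_num at hxy

theorem exists_div_eq_of_prime {B : Type*} [CommRing B] [IsDedekindDomain B] [Algebra B K]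
    [IsFractionRing B K] {I : Ideal B} (hI : I.IsPrime) (hI0 : I ≠ ⊥) (x : K) :
    ∃ s t : B, (s ∉ I ∨ t ∉ I) ∧ t ≠ 0 ∧ x = algebraMap B K s / algebraMap B K t := by
  obtain ⟨s, t, ht, rfl⟩ := IsFractionRing.div_surjective (A := B) x
  have ht0 := nonZeroDivisors.ne_zero ht
  have hinj := IsFractionRing.injective B K
  have := IsLocalization.AtPrime.isDiscreteValuationRing_of_dedekind_domain B hI0
    (Localization.AtPrime I)
  have hle : I.primeCompl ≤ nonZeroDivisors B := I.primeCompl_le_nonZeroDivisors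
  have hinj' := IsLocalization.injective (Localization.AtPrime I) hle
  have key : ∀ s t : B, ∀ c : Localization.AtPrime I, algebraMap B _ s * c = algebraMap B _ t →
      ∃ u v : B, v ∉ I ∧ s * u = t * v := by
    intro s t c h
    obtain ⟨u, ⟨v, hv⟩, rfl⟩ := IsLocalization.exists_mk'_eq I.primeCompl c
    refine ⟨u, v, hv, hinj' ?_⟩
    rw [map_mul, map_mul, ← h, mul_assoc, IsLocalization.mk'_spec]
  have hne : ∀ {b : B}, b ≠ 0 → algebraMap B K b ≠ 0 := fun h => by
    simpa using hinj.ne h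
  obtain ⟨c, h | h⟩ := ValuationRing.cond (algebraMap B (Localization.AtPrime I) s)
    (algebraMap B (Localization.AtPrime I) t)
  · obtain ⟨u, v, hv, h⟩ := key _ _ _ h
    have hv0 : v ≠ 0 := fun h => hv (h ▸ I.zero_mem)
    have hu0 : u ≠ 0 := by rintro rfl; simp_all
    refine ⟨v, u, .inl hv, hu0, ?_⟩
    rw [div_eq_div_iff (hne ht0) (hne hu0), ← map_mul, ← map_mul, h, mul_comm]
  · obtain ⟨u, v, hv, h⟩ := key _ _ _ h
    have hv0 : v ≠ 0 := fun h => hv (h ▸ I.zero_mem)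
    refine ⟨u, v, .inr hv, hv0, ?_⟩
    rw [div_eq_div_iff (hne ht0) (hne hv0), ← map_mul, ← map_mul, ← h, mul_comm]

theorem PlaceK.HasCenter.lt_one_iff {B : Type*} [CommRing B] [Algebra B K] {w : PlaceK K}
    {I : Ideal B} (h : w.HasCenter I) {s t : B} (hst : s ∉ I ∨ t ∉ I) (ht : algebraMap B K t ≠ 0) :
    w.v (algebraMap B K s / algebraMap B K t) < 1 ↔ s ∈ I := by
  have hpos : 0 < w.v (algebraMap B K t) := w.v.pos ht
  rw [map_div₀, div_lt_one hpos]
  constructor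
  · intro hlt
    by_contra hs
    have := (h s).2.not.1 hs
    linarith [(h t).1]
  · intro hs
    have h1 := (h s).2.1 hs
    have h2 := (h t).2.not.1 (hst.resolve_left (not_not.2 hs))
    linarith

theorem PlaceK.equiv_of_hasCenter {B : Type*} [CommRing B] [IsDedekindDomain B] [Algebra B K]
    [IsFractionRing B K] {I : Ideal B} (hI : I.IsPrime) (hI0 : I ≠ ⊥) {w w' : PlaceK K}
    (h : w.HasCenter I) (h' : w'.HasCenter I) : PlaceK.Equiv w w' := by
  intro x
  obtain ⟨s, t, hst, ht, rfl⟩ := exists_div_eq_of_prime hI hI0 x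
  have ht' : algebraMap B K t ≠ 0 := by
    simpa using (IsFractionRing.injective B K).ne ht
  rw [h.lt_one_iff hst ht', h'.lt_one_iff hst ht']

/-- Only finitely many places that are integral on a Dedekind domain `B` with fraction field `K`
make a given nonzero element of `K` small. -/
theorem AllButFinitelyManyPlaces.of_dedekind {κ : Subfield K} (B : Type*) [CommRing B]
    [IsDedekindDomain B] [Algebra B K] [IsFractionRing B K] {a : K} (ha : a ≠ 0) :
    AllButFinitelyManyPlaces K κ fun w =>
      (∀ b : B, w.v (algebraMap B K b) ≤ 1) → ¬ w.v a < 1 := by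
  obtain ⟨b, c, hc, rfl⟩ := IsFractionRing.div_surjective (A := B) a
  have hb : b ≠ 0 := by rintro rfl; simp at ha
  have hc : algebraMap B K c ≠ 0 := by
    simpa using (IsFractionRing.injective B K).ne (nonZeroDivisors.ne_zero hc)
  refine .of_finite_label (Ideal.finite_factors (I := Ideal.span {b}) (by simpa using hb))
    (fun w P => w.HasCenter P.asIdeal) ?_
    (fun w w' P => PlaceK.equiv_of_hasCenter P.isPrime P.ne_bot)
  intro w hw _ hQ
  push Not at hQ
  obtain ⟨hB, hlt⟩ := hQ
  obtain ⟨I, hI, hcen⟩ := PlaceK.exists_hasCenter hw hB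
  have hbI : b ∈ I := by
    refine (hcen b).2.2 (lt_of_lt_of_le ?_ (hB c))
    rwa [map_div₀, div_lt_one (w.v.pos hc)] at hlt
  refine ⟨⟨I, hI, ?_⟩, ?_, hcen⟩
  · rintro rfl
    exact hb (by simpa using hbI)
  · rw [Set.mem_ofPred_eq, Ideal.dvd_span_singleton]
    exact hbI

open scoped IntermediateField.algebraAdjoinAdjoin in
theorem AllButFinitelyManyPlaces.of_adjoin [CharZero K] {κ : Subfield K} (s : K)
    [FiniteDimensional (IntermediateField.adjoin κ {s}) K] {a : K} (ha : a ≠ 0) :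
    AllButFinitelyManyPlaces K κ fun w =>
      (∀ c ∈ κ, w.v c ≤ 1) → w.v s ≤ 1 → ¬ w.v a < 1 := by
  have : IsPrincipalIdealRing (Algebra.adjoin κ {s}) := by
    refine IsPrincipalIdealRing.of_surjective
      ((Polynomial.aeval (⟨s, Algebra.self_mem_adjoin_singleton κ s⟩ : Algebra.adjoin κ {s}) :
        κ[X] →ₐ[κ] _) : κ[X] →+* _) ?_
    rintro ⟨y, hy⟩
    obtain ⟨p, rfl⟩ := (Algebra.adjoin_singleton_eq_range_aeval κ s ▸ hy :)
    exact ⟨p, Subtype.ext (by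
      simp [Polynomial.aeval_def, Polynomial.eval₂_eq_sum_range])⟩
  have := integralClosure.isDedekindDomain (Algebra.adjoin κ {s})
    (IntermediateField.adjoin κ {s}) (L := K)
  have : IsFractionRing (integralClosure (Algebra.adjoin κ {s}) K) K :=
    integralClosure.isFractionRing_of_finite_extension (IntermediateField.adjoin κ {s}) K
  refine (of_dedekind (integralClosure (Algebra.adjoin κ {s}) K) ha).mono
    fun w hw h hκ hs => h fun b => ?_
  refine AbsoluteValue.le_one_of_isIntegral (A := Algebra.adjoin κ {s}) hw ?_ b.2
  rintro ⟨y, hy⟩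
  change w.v y ≤ 1
  induction hy using Algebra.adjoin_induction with
  | mem x hx => simpa [Set.mem_singleton_iff.1 hx] using hs
  | algebraMap r => exact hκ _ r.2
  | add x y _ _ hx hy => exact (hw _ _).trans (max_le hx hy)
  | mul x y _ _ hx hy =>
    rw [map_mul]
    exact mul_le_one₀ hx (w.v.nonneg _) hy

theorem NumberFieldOrFunctionFieldOver.charZero {κ : Subfield K}
    (hK : NumberFieldOrFunctionFieldOver K κ) : CharZero K :=
  hK.elim (fun h => h.to_charZero) fun h => h.1

theorem AllButFinitelyManyPlaces.not_lt_one {κ : Subfield K}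
    (hK : NumberFieldOrFunctionFieldOver K κ) {a : K} (ha : a ≠ 0) :
    AllButFinitelyManyPlaces K κ fun w => ¬ w.v a < 1 := by
  have := hK.charZero
  by_cases hN : NumberField K
  · refine (of_dedekind (NumberField.RingOfIntegers K) ha).mono fun w hw h => h fun b => ?_
    refine AbsoluteValue.le_one_of_isIntegral (A := ℤ) hw (fun a => ?_) b.isIntegral_coe
    simpa using IsNonarchimedean.apply_intCast_le_one (f := w.v) hw
  obtain ⟨_, ⟨t, ht, hfin⟩, -⟩ := hK.resolve_left hN
  have ht0 : t ≠ 0 := by rintro rfl; exact ht isAlgebraic_zero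
  have hadj : IntermediateField.adjoin κ {t⁻¹} = IntermediateField.adjoin κ {t} := by
    apply le_antisymm <;> rw [IntermediateField.adjoin_le_iff, Set.singleton_subset_iff]
    · exact inv_mem (IntermediateField.mem_adjoin_simple_self κ t)
    · simpa using inv_mem (IntermediateField.mem_adjoin_simple_self κ t⁻¹)
  have hfin' : FiniteDimensional (IntermediateField.adjoin κ {t⁻¹}) K := by rwa [hadj]
  obtain ⟨T, hT, h⟩ := (of_adjoin (κ := κ) t ha).and (of_adjoin (κ := κ) t⁻¹ ha)
  refine ⟨T, hT, fun w hw hκ => (h w hw hκ).imp id fun h => ?_⟩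
  have hκ' : ∀ c ∈ κ, w.v c ≤ 1 := fun c hc => by
    by_cases h0 : c = 0
    · simp [h0]
    · exact (hκ.resolve_left hN c hc h0).le
  rcases le_total (w.v t) 1 with h1 | h1
  · exact h.1 hκ' h1
  · exact h.2 hκ' (by rw [map_inv₀]; exact inv_le_one_of_one_le₀ h1)

theorem AllButFinitelyManyPlaces.eq_one {κ : Subfield K}
    (hK : NumberFieldOrFunctionFieldOver K κ) {a : K} (ha : a ≠ 0) :
    AllButFinitelyManyPlaces K κ fun w => w.v a = 1 := by
  refine ((not_lt_one hK ha).and (not_lt_one hK (inv_ne_zero ha))).mono fun w _ h => ?_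
  refine le_antisymm ?_ (not_lt.1 h.1)
  have := not_lt.1 h.2
  rw [map_inv₀] at this
  exact (one_le_inv₀ (w.v.pos ha)).1 this

theorem AllButFinitelyManyPlaces.le_one {κ : Subfield K}
    (hK : NumberFieldOrFunctionFieldOver K κ) (a : K) :
    AllButFinitelyManyPlaces K κ fun w => w.v a ≤ 1 := by
  by_cases ha : a = 0
  · exact .of_forall fun w => by simp [ha]
  · exact (eq_one hK ha).mono fun w _ h => h.le

theorem AllButFinitelyManyPlaces.coeff_le_one {κ : Subfield K}
    (hK : NumberFieldOrFunctionFieldOver K κ) (p : K[X]) :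
    AllButFinitelyManyPlaces K κ fun w => ∀ m, w.v (p.coeff m) ≤ 1 := by
  refine (forall_finset p.support fun m _ => le_one hK (p.coeff m)).mono fun w _ h m => ?_
  by_cases hm : m ∈ p.support
  · exact h m hm
  · simp [Polynomial.notMem_support_iff.1 hm]

end Places

section IntegralPolynomials

variable {L : Type*} [Field L] {v : AbsoluteValue L ℝ}

/-- The subring of elements of absolute value at most one. -/
def AbsoluteValue.unitBall (hv : IsNonarchimedean v) : Subring L where
  carrier := {x | v x ≤ 1}
  mul_mem' {a b} ha hb := by
    simp only [Set.mem_ofPred_eq, map_mul] at *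
    exact mul_le_one₀ ha (v.nonneg _) hb
  one_mem' := by simp
  add_mem' {a b} ha hb := (hv a b).trans (max_le ha hb)
  zero_mem' := by simp
  neg_mem' {a} ha := by simpa using ha

theorem AbsoluteValue.exists_map_unitBall (hv : IsNonarchimedean v) {p : L[X]}
    (hp : ∀ m, v (p.coeff m) ≤ 1) :
    ∃ q : (AbsoluteValue.unitBall hv)[X], q.map (AbsoluteValue.unitBall hv).subtype = p := by
  refine ⟨p.toSubring _ ?_, p.map_toSubring _ _⟩
  intro c hc
  obtain ⟨m, -, rfl⟩ := Polynomial.mem_coeffs_iff.1 hc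
  exact hp m

theorem AbsoluteValue.eval_le_one (hv : IsNonarchimedean v) {p : L[X]}
    (hp : ∀ m, v (p.coeff m) ≤ 1) {x : L} (hx : v x ≤ 1) : v (p.eval x) ≤ 1 := by
  obtain ⟨q, rfl⟩ := AbsoluteValue.exists_map_unitBall hv hp
  have := (q.eval (⟨x, hx⟩ : AbsoluteValue.unitBall hv)).2
  rwa [← Subring.subtype_apply, ← Polynomial.eval_map_apply] at this

theorem AbsoluteValue.eval_sub_eval_le (hv : IsNonarchimedean v) {p : L[X]}
    (hp : ∀ m, v (p.coeff m) ≤ 1) {x y : L} (hx : v x ≤ 1) (hy : v y ≤ 1) :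
    v (p.eval x - p.eval y) ≤ v (x - y) := by
  obtain ⟨q, rfl⟩ := AbsoluteValue.exists_map_unitBall hv hp
  obtain ⟨c, hc⟩ := Polynomial.sub_dvd_eval_sub (⟨x, hx⟩ : AbsoluteValue.unitBall hv) ⟨y, hy⟩ q
  have := congrArg (AbsoluteValue.unitBall hv).subtype hc
  rw [map_sub, ← Polynomial.eval_map_apply, ← Polynomial.eval_map_apply, map_mul] at this
  change _ = (x - y) * (c : L) at this
  change (q.map _).eval x - (q.map _).eval y = _ at this
  rw [this, map_mul]
  exact mul_le_of_le_one_right (v.nonneg _) c.2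

/-- An integral polynomial is an isometry near an integral point where its derivative is a unit. -/
theorem AbsoluteValue.eval_sub_eval_eq (hv : IsNonarchimedean v) {p : L[X]}
    (hp : ∀ m, v (p.coeff m) ≤ 1) {x y : L} (hy : v y ≤ 1) (hxy : v (x - y) < 1)
    (hd : v (p.derivative.eval y) = 1) : v (p.eval x - p.eval y) = v (x - y) := by
  obtain ⟨q, rfl⟩ := AbsoluteValue.exists_map_unitBall hv hp
  obtain ⟨c, hc⟩ := q.binomExpansion (⟨y, hy⟩ : AbsoluteValue.unitBall hv) ⟨x - y, hxy.le⟩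
  have := congrArg (AbsoluteValue.unitBall hv).subtype hc
  rw [map_add, map_add, map_mul, map_mul, ← Polynomial.eval_map_apply, ← Polynomial.eval_map_apply,
    ← Polynomial.eval_map_apply, ← Polynomial.derivative_map] at this
  change (q.map _).eval (y + (x - y)) = (q.map _).eval y + (derivative (q.map _)).eval y * (x - y)
    + (c : L) * (x - y) ^ 2 at this
  rw [add_sub_cancel] at this
  set p := q.map (AbsoluteValue.unitBall hv).subtype
  have h2 : p.eval x - p.eval y = (x - y) * (p.derivative.eval y + c * (x - y)) := by
    rw [this]; ring
  have hlt : v (c * (x - y)) < 1 := by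
    rw [map_mul]
    exact mul_lt_one_of_nonneg_of_lt_one_right c.2 (v.nonneg _) hxy
  have h3 : v (p.derivative.eval y + c * (x - y)) = 1 := by
    apply le_antisymm
    · exact (hv _ _).trans (max_le hd.le hlt.le)
    · by_contra! h
      have := hv (p.derivative.eval y + c * (x - y)) (-(c * (x - y)))
      rw [add_neg_cancel_right, hd, map_neg_eq_map] at this
      exact absurd this (not_le.2 (max_lt h hlt))
  rw [h2, map_mul, h3, mul_one]

theorem AbsoluteValue.iterate_eval_le_one (hv : IsNonarchimedean v) {p : L[X]}
    (hp : ∀ m, v (p.coeff m) ≤ 1) {x : L} (hx : v x ≤ 1) (k : ℕ) :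
    v ((fun a => p.eval a)^[k] x) ≤ 1 := by
  induction k with
  | zero => exact hx
  | succ k ih =>
    rw [Function.iterate_succ_apply']
    exact AbsoluteValue.eval_le_one hv hp ih

theorem AbsoluteValue.iterate_eval_sub_le (hv : IsNonarchimedean v) {p : L[X]}
    (hp : ∀ m, v (p.coeff m) ≤ 1) {x y : L} (hx : v x ≤ 1) (hy : v y ≤ 1) (k : ℕ) :
    v ((fun a => p.eval a)^[k] x - (fun a => p.eval a)^[k] y) ≤ v (x - y) := by
  induction k with
  | zero => exact le_rfl
  | succ k ih =>
    rw [Function.iterate_succ_apply', Function.iterate_succ_apply']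
    exact (AbsoluteValue.eval_sub_eval_le hv hp (AbsoluteValue.iterate_eval_le_one hv hp hx k)
      (AbsoluteValue.iterate_eval_le_one hv hp hy k)).trans ih

theorem AbsoluteValue.coeff_comp_le_one (hv : IsNonarchimedean v) {p q : L[X]}
    (hp : ∀ m, v (p.coeff m) ≤ 1) (hq : ∀ m, v (q.coeff m) ≤ 1) (m : ℕ) :
    v ((p.comp q).coeff m) ≤ 1 := by
  obtain ⟨p, rfl⟩ := AbsoluteValue.exists_map_unitBall hv hp
  obtain ⟨q, rfl⟩ := AbsoluteValue.exists_map_unitBall hv hq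
  rw [← Polynomial.map_comp, Polynomial.coeff_map]
  exact ((p.comp q).coeff m).2

theorem AbsoluteValue.coeff_iterate_comp_le_one (hv : IsNonarchimedean v) {p : L[X]}
    (hp : ∀ m, v (p.coeff m) ≤ 1) (k m : ℕ) : v ((p.comp^[k] X).coeff m) ≤ 1 := by
  induction k generalizing m with
  | zero =>
    rw [Function.iterate_zero_apply, Polynomial.coeff_X]
    split_ifs <;> simp
  | succ k ih =>
    rw [Function.iterate_succ_apply']
    exact AbsoluteValue.coeff_comp_le_one hv hp ih m

/-- If an orbit of an integral polynomial `p` comes arbitrarily close to a periodic point at which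
the multiplier is a unit, then it hits that point. -/
theorem AbsoluteValue.exists_iterate_eq_of_unit_multiplier (hv : IsNonarchimedean v) {p : L[X]}
    (hp : ∀ m, v (p.coeff m) ≤ 1) {M : ℕ} (hM : 0 < M) {x η : L} (hη : v η ≤ 1)
    (hper : (fun a => p.eval a)^[M] η = η)
    (hd : v ((p.comp^[M] X).derivative.eval η) = 1)
    (hcl : ∀ ε > 0, ∃ j, v ((fun a => p.eval a)^[j] x - η) < ε) :
    ∃ j, (fun a => p.eval a)^[j] x = η := by
  set g : L → L := fun a => p.eval a with hg
  obtain ⟨r, hr⟩ : ∃ r < M, ∀ ε > 0, ∃ t, v (g^[r + M * t] x - η) < ε := by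
    by_contra! h
    choose! e he h using h
    have h1 : ∃ ε > 0, ∀ r ∈ Finset.range M, ε ≤ e r := by
      have hne : (Finset.range M).Nonempty := Finset.nonempty_range_iff.2 hM.ne'
      refine ⟨(Finset.range M).inf' hne e, ?_, fun r hr => Finset.inf'_le _ hr⟩
      rw [gt_iff_lt, Finset.lt_inf'_iff]
      exact fun r hr => he r (Finset.mem_range.1 hr)
    obtain ⟨ε, hε, hle⟩ := h1
    obtain ⟨j, hj⟩ := hcl ε hε
    have hjM := Nat.mod_lt j hM
    have h2 := h (j % M) hjM (j / M)
    rw [Nat.mod_add_div] at h2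
    linarith [hle _ (Finset.mem_range.2 hjM)]
  obtain ⟨-, hr⟩ := hr
  have hstep : ∀ y, v (y - η) < 1 → v (g^[M] y - η) = v (y - η) := fun y hy => by
    have := AbsoluteValue.eval_sub_eval_eq hv (AbsoluteValue.coeff_iterate_comp_le_one hv hp M)
      hη hy hd
    rw [Polynomial.iterate_comp_eval, Polynomial.iterate_comp_eval, Polynomial.eval_X,
      Polynomial.eval_X, hper] at this
    exact this
  have hconst : ∀ y, v (y - η) < 1 → ∀ t, v (g^[M * t] y - η) = v (y - η) := fun y hy t => by
    induction t with
    | zero => rfl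
    | succ t ih =>
      rw [Nat.mul_succ, add_comm, Function.iterate_add_apply, hstep _ (ih ▸ hy), ih]
  have hadd : ∀ s t, g^[r + M * (s + t)] x = g^[M * t] (g^[r + M * s] x) := fun s t => by
    rw [← Function.iterate_add_apply]
    exact congrArg (fun i => g^[i] x) (by ring)
  obtain ⟨t₀, h₀⟩ := hr 1 one_pos
  by_contra! hne
  have hpos : 0 < v (g^[r + M * t₀] x - η) := v.pos (sub_ne_zero.2 (hne _))
  obtain ⟨t, ht⟩ := hr _ hpos
  rcases le_total t₀ t with h | h
  · obtain ⟨s, rfl⟩ := Nat.exists_eq_add_of_le h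
    rw [hadd, hconst _ h₀] at ht
    exact lt_irrefl _ ht
  · obtain ⟨s, rfl⟩ := Nat.exists_eq_add_of_le h
    rw [hadd, hconst _ (ht.trans (by rwa [← hadd]))] at ht
    exact lt_irrefl _ ht

end IntegralPolynomials

section Special

theorem exists_derivative_eval_iterate_eq_zero {F : Type*} [CommRing F] [IsDomain F] (f : F[X])
    {M : ℕ} {η : F} (h : (f.comp^[M] X).derivative.eval η = 0) :
    ∃ i < M, f.derivative.eval ((fun a => f.eval a)^[i] η) = 0 := by
  induction M with
  | zero => simp at h
  | succ M ih =>
    rw [Function.iterate_succ_apply', Polynomial.derivative_comp, Polynomial.eval_mul,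
      Polynomial.eval_comp, mul_eq_zero, Polynomial.iterate_comp_eval, Polynomial.eval_X] at h
    rcases h with h | h
    · obtain ⟨i, hi, h⟩ := ih h
      exact ⟨i, by omega, h⟩
    · exact ⟨M, by omega, h⟩

variable {F : Type} [Field F]

theorem Polynomial.Chebyshev.C_eval_add_inv (n : ℕ) {y : F} (hy : y ≠ 0) :
    (Chebyshev.C F n).eval (y + y⁻¹) = y ^ n + y⁻¹ ^ n := by
  induction n using Nat.twoStepInduction with
  | zero => norm_num
  | one => simp
  | more n h1 h2 =>
    push_cast at h1 h2 ⊢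
    rw [Chebyshev.C_add_two, Polynomial.eval_sub, Polynomial.eval_mul, Polynomial.eval_X, h1, h2]
    linear_combination (y ^ n + y⁻¹ ^ n) * mul_inv_cancel₀ hy

theorem Polynomial.Chebyshev.derivative_C_eval [NeZero (2 : F)] (n : ℕ) (x : F) :
    (Chebyshev.C F n).derivative.eval x = n * (Chebyshev.S F (n - 1)).eval x := by
  have h2 : (2 : F) ≠ 0 := NeZero.ne _
  have h := congrArg (fun p => (derivative p).eval (x / 2)) (Chebyshev.C_comp_two_mul_X F n)
  have hS := congrArg (fun p => p.eval (x / 2)) (Chebyshev.S_comp_two_mul_X F (n - 1))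
  simp only [Polynomial.derivative_comp, Polynomial.derivative_mul, Polynomial.derivative_ofNat,
    Polynomial.derivative_X, Polynomial.eval_mul, Polynomial.eval_comp, Polynomial.eval_X,
    Polynomial.eval_ofNat, Polynomial.eval_add, Polynomial.eval_zero, Polynomial.eval_one,
    Chebyshev.T_derivative_eq_U, Polynomial.eval_natCast, mul_div_cancel₀ _ h2,
    Int.cast_natCast] at h hS
  rw [hS]
  apply mul_left_cancel₀ h2
  linear_combination h

theorem exists_add_inv_eq [IsAlgClosed F] (x : F) : ∃ y : F, y ≠ 0 ∧ y + y⁻¹ = x := by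
  obtain ⟨y, hy⟩ := IsAlgClosed.exists_root (X ^ 2 - C x * X + 1 : F[X])
    (by rw [show (X ^ 2 - C x * X + 1 : F[X]).degree = 2 by compute_degree!]; norm_num)
  simp only [Polynomial.IsRoot, Polynomial.eval_add, Polynomial.eval_sub, Polynomial.eval_pow,
    Polynomial.eval_X, Polynomial.eval_mul, Polynomial.eval_C, Polynomial.eval_one] at hy
  have hy0 : y ≠ 0 := by rintro rfl; simp at hy
  refine ⟨y, hy0, ?_⟩
  field_simp
  linear_combination hy

theorem IsChebyshevPoly.eq_C [IsAlgClosed F] {d : ℕ} {g : F[X]} (hg : IsChebyshevPoly d g) :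
    g = Chebyshev.C F d := by
  refine Polynomial.funext fun x => ?_
  obtain ⟨y, hy, rfl⟩ := exists_add_inv_eq x
  rw [hg y hy, Chebyshev.C_eval_add_inv d hy]

/-- A periodic point of `±C_d` is not a critical point. -/
theorem chebyshev_derivative_ne_zero_of_periodic [CharZero F] {d : ℕ} (hd : 0 < d) {ε : F}
    (hε : ε ^ 2 = 1) {M : ℕ} (hM : 0 < M) {τ : F}
    (hper : (fun a => (C ε * Chebyshev.C F d).eval a)^[M] τ = τ) :
    (C ε * Chebyshev.C F d).derivative.eval τ ≠ 0 := by
  intro hcrit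
  have hε0 : ε ≠ 0 := by rintro rfl; simp at hε
  have hd0 : (d : F) ≠ 0 := Nat.cast_ne_zero.2 hd.ne'
  rw [Polynomial.derivative_C_mul, Polynomial.eval_mul, Polynomial.eval_C,
    Chebyshev.derivative_C_eval, mul_eq_zero, mul_eq_zero] at hcrit
  have hS := (hcrit.resolve_left hε0).resolve_left hd0
  set g : F → F := fun a => (C ε * Chebyshev.C F d).eval a with hg
  have h1 := congrArg (Polynomial.eval τ) (Chebyshev.S_sq_add_S_sq F (d - 1))
  have h2 := congrArg (Polynomial.eval τ) (Chebyshev.C_eq_S_sub_X_mul_S F d)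
  simp only [sub_add_cancel, Polynomial.eval_sub, Polynomial.eval_add, Polynomial.eval_pow,
    Polynomial.eval_mul, Polynomial.eval_X, Polynomial.eval_one, hS, Polynomial.eval_ofNat] at h1 h2
  have hsq : g τ ^ 2 = 4 := by
    simp only [hg, Polynomial.eval_mul, Polynomial.eval_C, h2]
    linear_combination 4 * h1 + 4 * (Polynomial.eval τ (Chebyshev.S F d)) ^ 2 * hε
  have hpm : ∀ a : F, a ^ 2 = 4 → a = 2 ∨ a = -2 := fun a ha => by
    rw [← sq_eq_sq_iff_eq_or_eq_neg]
    linear_combination ha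
  have hneg : ∀ z : ℤ, ((z.negOnePow : ℤ) : F) ^ 2 = 1 := fun z => by
    rcases Int.even_or_odd z with h | h
    · simp [Int.negOnePow_even z h]
    · simp [Int.negOnePow_odd z h]
  have hstep : ∀ a : F, a ^ 2 = 4 → g a ^ 2 = 4 := fun a ha => by
    simp only [hg, Polynomial.eval_mul, Polynomial.eval_C]
    rcases hpm a ha with rfl | rfl
    · rw [Chebyshev.C_eval_two]
      linear_combination 4 * hε
    · rw [Chebyshev.C_eval_neg_two]
      have := hneg d
      linear_combination 4 * hε + 4 * ε ^ 2 * this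
  have hiter : ∀ (m : ℕ) (a : F), a ^ 2 = 4 → (g^[m] a) ^ 2 = 4 := fun m => by
    induction m with
    | zero => exact fun a ha => ha
    | succ m ih => exact fun a ha => ih _ (hstep a ha)
  have hτ : τ ^ 2 = 4 := by
    obtain ⟨m, rfl⟩ := Nat.exists_eq_succ_of_ne_zero hM.ne'
    rw [← hper, Function.iterate_succ_apply]
    exact hiter m _ hsq
  rcases hpm τ hτ with rfl | rfl
  · rw [Chebyshev.S_eval_two] at hS
    simp [hd.ne'] at hS
  · rw [Chebyshev.S_eval_neg_two] at hS
    have := hneg (d - 1)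
    simp [hd.ne'] at hS

/-- A superattracting periodic point of a special polynomial is totally invariant. -/
theorem IsSpecialPolyAux.eq_of_superattracting [IsAlgClosed F] [CharZero F] {f : F[X]}
    (hf : 2 ≤ f.natDegree) (hsp : IsSpecialPolyAux f) {M : ℕ} (hM : 0 < M) {η : F}
    (hper : (fun a => f.eval a)^[M] η = η) (hd : (f.comp^[M] X).derivative.eval η = 0) :
    ∃ a : F, a ≠ 0 ∧ f = C a * (X - C η) ^ f.natDegree + C η := by
  obtain ⟨α, β, hα, g, hg, hconj⟩ := hsp
  obtain ⟨i, -, hi⟩ := exists_derivative_eval_iterate_eq_zero f hd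
  have hev : ∀ t, α * g.eval t + β = f.eval (α * t + β) := fun t => by
    simpa using congrArg (Polynomial.eval t) hconj
  have hder : ∀ t, g.derivative.eval t = f.derivative.eval (α * t + β) := fun t => by
    have := congrArg (fun p => (derivative p).eval t) hconj
    simp [Polynomial.derivative_comp] at this
    exact (this.resolve_right hα)
  set G : F → F := fun a => f.eval a
  have hsemi : Function.Semiconj (fun t => α * t + β) (fun t => g.eval t) G := hev
  have hinj : Function.Injective fun t => α * t + β := fun s t h => by
    simpa [hα] using h
  obtain ⟨τ, hτ⟩ : ∃ τ, α * τ + β = G^[i] η := ⟨(G^[i] η - β) / α, by field_simp; ring⟩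
  have hperG : G^[M] (G^[i] η) = G^[i] η := by
    rw [← Function.iterate_add_apply, add_comm, Function.iterate_add_apply, hper]
  have hperg : (fun t => g.eval t)^[M] τ = τ := by
    apply hinj
    refine (hsemi.iterate_right M τ).trans ?_
    change G^[M] (α * τ + β) = α * τ + β
    rw [hτ, hperG]
  have hcrit : g.derivative.eval τ = 0 := by rw [hder, hτ, hi]
  have hcheb : ∀ ε : F, ε ^ 2 = 1 → g ≠ C ε * Chebyshev.C F f.natDegree := by
    rintro ε hε rfl
    exact chebyshev_derivative_ne_zero_of_periodic (by omega) hε hM hperg hcrit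
  rcases hg with rfl | hg | hg
  · have hτ0 : τ = 0 := by
      rw [Polynomial.derivative_X_pow, Polynomial.eval_mul, Polynomial.eval_C, mul_eq_zero] at hcrit
      have := hcrit.resolve_left (Nat.cast_ne_zero.2 (by omega))
      rw [Polynomial.eval_pow, Polynomial.eval_X] at this
      exact eq_zero_of_pow_eq_zero this
    have hfe : ∀ x, f.eval x = α * ((x - β) / α) ^ f.natDegree + β := fun x => by
      have := hev ((x - β) / α)
      rw [mul_div_cancel₀ _ hα, sub_add_cancel, Polynomial.eval_pow, Polynomial.eval_X] at this
      exact this.symm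
    have hfix : G β = β := by
      change f.eval β = β
      rw [hfe, sub_self, zero_div, zero_pow (by omega), mul_zero, zero_add]
    have hiβ : G^[i] η = β := by rw [← hτ, hτ0]; ring
    have hηβ : η = β := by
      have h1 : G^[M * i] η = η := by
        rw [Function.iterate_mul]
        exact Function.iterate_fixed hper i
      have h2 : M * i = (M * i - i) + i := by
        have := Nat.le_mul_of_pos_left i hM
        omega
      rw [← h1, h2, Function.iterate_add_apply, hiβ, Function.iterate_fixed hfix]
    refine ⟨α / α ^ f.natDegree, div_ne_zero hα (pow_ne_zero _ hα), Polynomial.funext fun x => ?_⟩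
    rw [hfe, hηβ]
    simp only [Polynomial.eval_add, Polynomial.eval_mul, Polynomial.eval_C, Polynomial.eval_pow,
      Polynomial.eval_sub, Polynomial.eval_X]
    rw [div_pow]
    ring
  · exact (hcheb 1 (by norm_num) (by rw [map_one, one_mul]; exact hg.eq_C)).elim
  · exact (hcheb (-1) (by norm_num) (by
      rw [map_neg, map_one, neg_one_mul, ← hg.eq_C, neg_neg])).elim

end Special

section Coprime

theorem Polynomial.map_iterate_comp_X {R S : Type*} [CommSemiring R] [CommSemiring S] (φ : R →+* S)
    (p : R[X]) (m : ℕ) : (p.comp^[m] X).map φ = (p.map φ).comp^[m] X := by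
  induction m with
  | zero => simp
  | succ m ih => rw [Function.iterate_succ_apply', Function.iterate_succ_apply',
      Polynomial.map_comp, ih]

variable {K : Type} [Field K] [CharZero K]

/-- Dichotomy for the periodic points of a special polynomial: away from at most one totally
invariant point, the multipliers are nonzero, uniformly in the sense of a Bézout identity. -/
theorem IsSpecialPoly.exists_isCoprime_derivative {f : K[X]} (hf : 2 ≤ f.natDegree)
    (hsp : IsSpecialPoly f) {M : ℕ} (hM : 0 < M) :
    ∃ Ψ : K[X], IsCoprime Ψ (f.comp^[M] X).derivative ∧
      (f.comp^[M] X - X = Ψ ∨ ∃ a c : K, a ≠ 0 ∧ f = C a * (X - C c) ^ f.natDegree + C c ∧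
        f.comp^[M] X - X = (X - C c) * Ψ) := by
  set φ := algebraMap K (AlgebraicClosure K) with hφ
  have hφi : Function.Injective φ := φ.injective
  have hdeg : (f.map φ).natDegree = f.natDegree := Polynomial.natDegree_map φ
  have hmap := Polynomial.map_iterate_comp_X φ f
  set N := f.comp^[M] X with hN
  have hroot : ∀ η : AlgebraicClosure K, aeval η (N - X) = 0 → aeval η (derivative N) = 0 →
      ∃ a : AlgebraicClosure K, a ≠ 0 ∧ f.map φ = C a * (X - C η) ^ f.natDegree + C η := by
    intro η h1 h2
    rw [← hdeg]
    refine IsSpecialPolyAux.eq_of_superattracting (by rw [hdeg]; exact hf) hsp hM ?_ ?_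
    · rw [map_sub, aeval_X, sub_eq_zero, ← Polynomial.eval_map_algebraMap, hmap,
        Polynomial.iterate_comp_eval, Polynomial.eval_X] at h1
      exact h1
    · rw [← Polynomial.eval_map_algebraMap, ← Polynomial.derivative_map, hmap] at h2
      exact h2
  by_cases hcop : IsCoprime (N - X) N.derivative
  · exact ⟨_, hcop, Or.inl rfl⟩
  rw [Polynomial.isCoprime_iff_aeval_ne_zero_of_isAlgClosed K (AlgebraicClosure K)] at hcop
  push Not at hcop
  obtain ⟨η, hη1, hη2⟩ := hcop
  obtain ⟨α, hα, hfα⟩ := hroot η hη1 hη2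
  obtain ⟨d, hd⟩ : ∃ d, f.natDegree = d + 2 := ⟨f.natDegree - 2, by omega⟩
  have hdK : ((d + 2 : ℕ) : AlgebraicClosure K) ≠ 0 := Nat.cast_ne_zero.2 (by omega)
  have hcoeff : ∀ (α η : AlgebraicClosure K), f.map φ = C α * (X - C η) ^ f.natDegree + C η →
      φ (f.coeff (d + 2)) = α ∧ φ (f.coeff (d + 1)) = α * (-η * (d + 2 : ℕ)) := by
    intro α η h
    rw [← Polynomial.coeff_map, ← Polynomial.coeff_map, h, hd]
    rw [show (X : (AlgebraicClosure K)[X]) - C η = X + C (-η) by rw [map_neg, sub_eq_add_neg],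
      Polynomial.coeff_add, Polynomial.coeff_add, Polynomial.coeff_C_mul, Polynomial.coeff_C_mul,
      Polynomial.coeff_X_add_C_pow, Polynomial.coeff_X_add_C_pow]
    simp
    exact Or.inl (Or.inl (by ring))
  set a := f.coeff (d + 2)
  set c := -(f.coeff (d + 1)) / (a * (d + 2 : ℕ))
  have hc : ∀ (α η : AlgebraicClosure K), α ≠ 0 →
      f.map φ = C α * (X - C η) ^ f.natDegree + C η → φ a = α ∧ φ c = η := by
    intro α η hα h
    obtain ⟨h1, h2⟩ := hcoeff α η h
    refine ⟨h1, ?_⟩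
    simp only [c, map_div₀, map_neg, map_mul, h1, h2, map_natCast]
    field_simp
  obtain ⟨rfl, rfl⟩ := hc α η hα hfα
  have hfK : f = C a * (X - C c) ^ f.natDegree + C c := by
    apply Polynomial.map_injective φ hφi
    rw [hfα]
    simp
  have hNc : N.eval c = c := by
    apply hφi
    rw [map_sub, aeval_X, sub_eq_zero, Polynomial.aeval_algebraMap_apply] at hη1
    simpa using hη1
  have hN'c : N.derivative.eval c = 0 := by
    apply hφi
    rw [Polynomial.aeval_algebraMap_apply] at hη2
    simpa using hη2
  obtain ⟨Ψ, hΨ⟩ : X - C c ∣ N - X := by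
    rw [Polynomial.dvd_iff_isRoot, Polynomial.IsRoot, Polynomial.eval_sub, hNc, Polynomial.eval_X,
      sub_self]
  refine ⟨Ψ, ?_, Or.inr ⟨a, c, (map_ne_zero φ).1 hα, hfK, hΨ⟩⟩
  rw [Polynomial.isCoprime_iff_aeval_ne_zero_of_isAlgClosed K (AlgebraicClosure K)]
  by_contra! h
  obtain ⟨ζ, hζ1, hζ2⟩ := h
  obtain ⟨α', hα', hfα'⟩ := hroot ζ (by rw [hΨ, map_mul, hζ1, mul_zero]) hζ2
  obtain ⟨-, rfl⟩ := hc α' ζ hα' hfα'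
  rw [Polynomial.aeval_algebraMap_apply, map_eq_zero_iff _ hφi] at hζ1
  have := congrArg (fun p => (derivative p).eval c) hΨ
  simp only [Polynomial.derivative_sub, Polynomial.derivative_X, Polynomial.derivative_mul,
    Polynomial.derivative_C, Polynomial.eval_sub, Polynomial.eval_add, Polynomial.eval_mul,
    Polynomial.eval_X, Polynomial.eval_C, Polynomial.eval_one, hN'c, Polynomial.eval_zero] at this
  rw [Polynomial.coe_aeval_eq_eval] at hζ1
  rw [hζ1] at this
  norm_num at this

end Coprime

section ZarClosed

@[simp]
theorem homCoords_infty {L : Type} [CommRing L] : homCoords (∞ : OnePoint L) = ![1, 0] :=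
  rfl

@[simp]
theorem homCoords_coe {L : Type} [CommRing L] (a : L) : homCoords (a : OnePoint L) = ![a, 1] :=
  rfl

theorem homCoords_ext {L : Type} [CommRing L] [Nontrivial L] {x y : OnePoint L}
    (h : homCoords x 0 * homCoords y 1 = homCoords x 1 * homCoords y 0) : x = y := by
  induction x using OnePoint.rec <;> induction y using OnePoint.rec <;> simp_all

theorem MultiHomog.map {K L ι : Type} [CommRing K] [CommRing L] [DecidableEq ι] (φ : K →+* L)
    {p : MvPolynomial (ι × Fin 2) K} (hp : MultiHomog p) : MultiHomog (MvPolynomial.map φ p) :=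
  fun i => (hp i).imp fun d hd m hm => hd fun h0 => hm (by rw [MvPolynomial.coeff_map, h0, map_zero])

theorem ClosedSubvar.isZarClosed_pts {K L ι : Type} [CommRing K] [CommRing L] [DecidableEq ι]
    (V : ClosedSubvar K ι) (φ : K →+* L) : IsZarClosed (V.pts φ) := by
  refine ⟨⟨MvPolynomial.map φ '' V.polys, ?_⟩, ?_⟩
  · rintro _ ⟨p, hp, rfl⟩
    exact (V.homog p hp).map φ
  · ext x
    simp [ClosedSubvar.pts, vanishesAt, MvPolynomial.map_id]

variable {L ι : Type} [Field L]

/-- The ideal of all polynomials vanishing at the homogeneous coordinates of the points of `S`. -/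
noncomputable def homVanishingIdeal (S : Set (ι → OnePoint L)) : Ideal (MvPolynomial (ι × Fin 2) L) :=
  ⨅ x ∈ S, RingHom.ker (MvPolynomial.eval fun jk : ι × Fin 2 => homCoords (x jk.1) jk.2)

theorem mem_homVanishingIdeal {S : Set (ι → OnePoint L)} {p : MvPolynomial (ι × Fin 2) L} :
    p ∈ homVanishingIdeal S ↔
      ∀ x ∈ S, MvPolynomial.eval (fun jk : ι × Fin 2 => homCoords (x jk.1) jk.2) p = 0 := by
  simp [homVanishingIdeal, RingHom.mem_ker]

variable [DecidableEq ι]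

theorem IsZarClosed.inter {S T : Set (ι → OnePoint L)} (hS : IsZarClosed S)
    (hT : IsZarClosed T) : IsZarClosed (S ∩ T) := by
  obtain ⟨V, rfl⟩ := hS
  obtain ⟨W, rfl⟩ := hT
  refine ⟨⟨V.polys ∪ W.polys, fun p hp => hp.elim (V.homog p) (W.homog p)⟩, ?_⟩
  ext x
  simp only [ClosedSubvar.pts, Set.mem_inter_iff, Set.mem_ofPred_eq, Set.mem_union, or_imp,
    forall_and]

theorem isZarClosed_singleton (x : ι → OnePoint L) : IsZarClosed {x} := by
  refine ⟨⟨Set.range fun i => MvPolynomial.C (homCoords (x i) 0) * MvPolynomial.X (i, 1) -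
    MvPolynomial.C (homCoords (x i) 1) * MvPolynomial.X (i, 0), ?_⟩, ?_⟩
  · rintro _ ⟨i, rfl⟩ j
    refine ⟨0 + if i = j then 1 else 0, ?_⟩
    refine Submodule.sub_mem (MvPolynomial.weightedHomogeneousSubmodule L _ _) ?_ ?_
    · exact (MvPolynomial.isWeightedHomogeneous_C _ _).mul
        (MvPolynomial.isWeightedHomogeneous_X L _ (i, (1 : Fin 2)))
    · exact (MvPolynomial.isWeightedHomogeneous_C _ _).mul
        (MvPolynomial.isWeightedHomogeneous_X L _ (i, (0 : Fin 2)))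
  · ext y
    simp only [Set.mem_singleton_iff, ClosedSubvar.pts, vanishesAt, Set.mem_ofPred_eq,
      Set.forall_mem_range, map_sub, map_mul, MvPolynomial.map_id, MvPolynomial.eval_C,
      MvPolynomial.eval_X]
    constructor
    · rintro rfl i
      ring
    · intro h
      funext i
      exact (homCoords_ext (sub_eq_zero.1 (h i))).symm

theorem homVanishingIdeal_lt {S T : Set (ι → OnePoint L)} (hS : IsZarClosed S) (hST : S ⊂ T) :
    homVanishingIdeal T < homVanishingIdeal S := by
  obtain ⟨V, rfl⟩ := hS
  refine lt_of_le_not_ge (fun p hp => mem_homVanishingIdeal.2 fun x hx =>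
    mem_homVanishingIdeal.1 hp x (hST.1 hx)) fun hle => hST.2 fun x hx p hp => ?_
  have := hle (mem_homVanishingIdeal.2 fun y hy => by
    simpa only [vanishesAt, MvPolynomial.map_id, RingHom.id_apply] using hy p hp)
  simpa only [vanishesAt, MvPolynomial.map_id, RingHom.id_apply] using
    mem_homVanishingIdeal.1 this x hx

/-- An infinite closed subset contains an infinite irreducible closed subset. -/
theorem IsZarClosed.exists_irrSubvar_infinite [Finite ι] {S : Set (ι → OnePoint L)}
    (hS : IsZarClosed S) (hinf : S.Infinite) : ∃ T ⊆ S, IrrSubvar T ∧ T.Infinite := by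
  have hwf : WellFounded (InvImage (· > ·) (homVanishingIdeal (L := L) (ι := ι))) :=
    InvImage.wf _ wellFounded_gt
  obtain ⟨T, ⟨hTS, hT, hTinf⟩, hmin⟩ := hwf.has_min
    {T | T ⊆ S ∧ IsZarClosed T ∧ T.Infinite} ⟨S, subset_rfl, hS, hinf⟩
  have key : ∀ Z, IsZarClosed Z → (T ∩ Z).Infinite → T ⊆ Z := by
    intro Z hZ hTZ
    by_contra hnot
    exact hmin (T ∩ Z) ⟨Set.inter_subset_left.trans hTS, hT.inter hZ, hTZ⟩
      (homVanishingIdeal_lt (hT.inter hZ) (Set.inter_ssubset_left_iff.2 hnot))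
  refine ⟨T, hTS, ⟨hTinf.nonempty, hT, fun Z₁ Z₂ h₁ h₂ hsub => ?_⟩, hTinf⟩
  rw [← Set.inter_eq_left.2 hsub, Set.inter_union_distrib_left, Set.infinite_union] at hTinf
  exact hTinf.imp (key Z₁ h₁) (key Z₂ h₂)

theorem irrSubvar_singleton (x : ι → OnePoint L) : IrrSubvar {x} :=
  ⟨Set.singleton_nonempty x, isZarClosed_singleton x, fun Z₁ Z₂ _ _ h => by
    simpa only [Set.singleton_subset_iff, Set.mem_union] using h⟩

theorem IsZarClosed.finite_of_varDim_eq_zero [Finite ι] {S : Set (ι → OnePoint L)}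
    (hS : IsZarClosed S) (hdim : varDim S = ((0 : ℕ∞) : WithBot ℕ∞)) : S.Finite := by
  by_contra hinf
  obtain ⟨T, hTS, hT, hTinf⟩ := hS.exists_irrSubvar_infinite hinf
  obtain ⟨x, hx⟩ := hTinf.nonempty
  have hpos : 0 < varDim S := Order.krullDim_pos_iff.2
    ⟨⟨{x}, irrSubvar_singleton x, Set.singleton_subset_iff.2 (hTS hx)⟩, ⟨T, hT, hTS⟩, by
      refine lt_of_le_of_ne (Set.singleton_subset_iff.2 hx) fun h => hTinf ?_
      have hxT : {x} = T := congrArg Subtype.val h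
      exact hxT ▸ Set.finite_singleton x⟩
  rw [hdim] at hpos
  exact lt_irrefl _ hpos

end ZarClosed

section Transfer

/-- A self-map which permutes the `k`-th image of a finite set is preperiodic on this set, with a
uniform preperiod and a uniform period. -/
theorem Set.Finite.exists_iterate_add_eq {α : Type*} {φ : α → α} {S : Set α} (hS : S.Finite)
    {k m : ℕ} (hm : 0 < m) (h : φ^[m] '' (φ^[k] '' S) = φ^[k] '' S) :
    ∃ M, 0 < M ∧ ∀ x ∈ S, φ^[k + M] x = φ^[k] x := by
  set W := φ^[k] '' S
  have hW : Finite W := (hS.image _).to_subtype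
  have hmaps : Set.MapsTo φ^[m] W W := Set.mapsTo_iff_image_subset.2 h.subset
  have hsurj : Function.Surjective (hmaps.restrict φ^[m] W W) := by
    rintro ⟨y, hy⟩
    obtain ⟨x, hx, hxy⟩ := h.symm ▸ hy
    exact ⟨⟨x, hx⟩, Subtype.ext hxy⟩
  let σ := Equiv.ofBijective _ ⟨Finite.injective_iff_surjective.2 hsurj, hsurj⟩
  refine ⟨m * orderOf σ, Nat.mul_pos hm (orderOf_pos σ), fun x hx => ?_⟩
  have h1 := congrArg (fun τ : Equiv.Perm W => ((τ ⟨_, Set.mem_image_of_mem _ hx⟩ : W) : α))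
    (pow_orderOf_eq_one σ)
  rw [add_comm, Function.iterate_add_apply, Function.iterate_mul]
  rw [← Equiv.Perm.iterate_eq_pow] at h1
  change (((hmaps.restrict φ^[m] W W)^[orderOf σ] _ : W) : α) = _ at h1
  rw [hmaps.iterate_restrict] at h1
  exact h1

theorem polyEvalP1_iterate_coe {L : Type} [CommRing L] (f : L[X]) (k : ℕ) (a : L) :
    (polyEvalP1 f)^[k] (a : OnePoint L) = ((fun a => f.eval a)^[k] a : L) := by
  induction k generalizing a with
  | zero => rfl
  | succ k ih => exact ih _

theorem polyEvalP1_iterate_infty {L : Type} [CommRing L] (f : L[X]) (k : ℕ) :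
    (polyEvalP1 f)^[k] (∞ : OnePoint L) = ∞ :=
  Function.iterate_fixed rfl k

theorem splitMap_iterate_apply {L ι : Type} [CommRing L] (f : L[X]) (k : ℕ)
    (x : ι → OnePoint L) (i : ι) : (splitMap f)^[k] x i = (polyEvalP1 f)^[k] (x i) := by
  induction k generalizing x with
  | zero => rfl
  | succ k ih => exact ih _

open Classical in
/-- The point of `(P^1)^ι` with coordinate `∞` at the indices in `s`, and `z j` elsewhere. -/
noncomputable def patternPoint {ι L : Type} (s : Set ι) (z : ι → L) : ι → OnePoint L :=
  fun j => if j ∈ s then ∞ else (z j : OnePoint L)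

open Classical in
/-- Dehomogenization on the affine chart of the points with coordinates `∞` exactly on `s`. -/
noncomputable def dehomog {ι : Type} (K : Type) [CommRing K] (s : Set ι) :
    MvPolynomial (ι × Fin 2) K →ₐ[K] MvPolynomial ι K :=
  MvPolynomial.aeval fun jk =>
    if jk.1 ∈ s then ![1, 0] jk.2 else ![MvPolynomial.X jk.1, 1] jk.2

theorem eval₂_dehomog {ι K L : Type} [CommRing K] [CommRing L] [DecidableEq ι] (φ : K →+* L)
    (s : Set ι) (z : ι → L) (p : MvPolynomial (ι × Fin 2) K) :
    MvPolynomial.eval₂ φ z (dehomog K s p) = 0 ↔ vanishesAt φ p (patternPoint s z) := by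
  rw [vanishesAt, MvPolynomial.eval_map]
  suffices h : (MvPolynomial.eval₂Hom φ z).comp (dehomog K s : _ →+* MvPolynomial ι K) =
      MvPolynomial.eval₂Hom φ fun jk : ι × Fin 2 => homCoords (patternPoint s z jk.1) jk.2 by
    rw [← MvPolynomial.coe_eval₂Hom, ← MvPolynomial.coe_eval₂Hom, ← h]
    rfl
  refine MvPolynomial.ringHom_ext (fun c => ?_) ?_
  · simp [dehomog]
  · rintro ⟨j, e⟩
    by_cases hj : j ∈ s <;> fin_cases e <;> simp [dehomog, patternPoint, hj]

/-- A polynomial relation satisfied by all finite coordinates of all geometric points of `V`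
is satisfied by the finite coordinates of the points of `V` over any extension. -/
theorem ClosedSubvar.eval₂_eq_zero_of_geometric {ι K L : Type} [Field K] [Field L] [Finite ι]
    [DecidableEq ι] (V : ClosedSubvar K ι) {G : K[X]}
    (hG : ∀ x ∈ V.pts (algebraMap K (AlgebraicClosure K)), ∀ i, ∀ z : AlgebraicClosure K,
      x i = z → aeval z G = 0)
    {φ : K →+* L} {Q : ι → OnePoint L} (hQ : Q ∈ V.pts φ) {i : ι} {ζ : L} (hζ : Q i = ζ) :
    G.eval₂ φ ζ = 0 := by
  set s := {j | Q j = ∞} with hs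
  have his : i ∉ s := fun h => OnePoint.coe_ne_infty ζ (hζ.symm.trans h)
  obtain ⟨q, hq⟩ : ∃ q, Q = patternPoint s q := by
    choose q hq using fun j => (show ∃ a : L, j ∉ s → Q j = a from by
      by_cases hj : j ∈ s
      · exact ⟨0, fun h => (h hj).elim⟩
      · obtain ⟨a, ha⟩ := OnePoint.ne_infty_iff_exists.1 hj
        exact ⟨a, fun _ => ha.symm⟩)
    refine ⟨q, funext fun j => ?_⟩
    by_cases hj : j ∈ s
    · exact hj.trans (if_pos hj).symm
    · exact (hq j hj).trans (if_neg hj).symm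
  set J := Ideal.span (dehomog K s '' V.polys)
  have hmem : aeval (MvPolynomial.X i) G ∈ J.radical := by
    rw [← MvPolynomial.vanishingIdeal_zeroLocus_eq_radical (K := AlgebraicClosure K)]
    intro z hz
    rw [MvPolynomial.zeroLocus_span] at hz
    rw [← Polynomial.aeval_algHom_apply, MvPolynomial.aeval_X]
    refine hG (patternPoint s z) (fun p hp => ?_) i (z i) (by simp [patternPoint, his])
    rw [← eval₂_dehomog]
    exact hz _ ⟨p, hp, rfl⟩
  obtain ⟨N, hN⟩ := hmem
  have hJ : J ≤ RingHom.ker (MvPolynomial.eval₂Hom φ q) := by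
    rw [Ideal.span_le]
    rintro _ ⟨p, hp, rfl⟩
    refine (eval₂_dehomog φ s q p).2 ?_
    rw [← hq]
    exact hQ p hp
  have h0 := hJ hN
  rw [RingHom.mem_ker, map_pow] at h0
  have hqi : q i = ζ := by
    rw [hq, patternPoint, if_neg his] at hζ
    exact OnePoint.coe_injective hζ
  have h1 := eq_zero_of_pow_eq_zero h0
  rw [Polynomial.aeval_def, Polynomial.hom_eval₂, MvPolynomial.algebraMap_eq,
    MvPolynomial.eval₂Hom_comp_C, MvPolynomial.coe_eval₂Hom, MvPolynomial.eval₂_X, hqi] at h1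
  exact h1

/-- Uniform preperiodicity of the points of a zero-dimensional preperiodic subvariety, over
arbitrary extensions of the base field. -/
theorem ClosedSubvar.exists_iterate_add_eq {ι K : Type} [Field K] [Finite ι]
    [DecidableEq ι] (V : ClosedSubvar K ι) (f : K[X])
    (hVdim : varDim (V.pts (algebraMap K (AlgebraicClosure K))) = ((0 : ℕ∞) : WithBot ℕ∞))
    (hVpre : SubvarPreperiodic (f.map (algebraMap K (AlgebraicClosure K)))
      (V.pts (algebraMap K (AlgebraicClosure K)))) :
    ∃ k M, 0 < M ∧ ∀ (L : Type) [Field L] (φ : K →+* L), ∀ Q ∈ V.pts φ, ∀ i, ∀ ζ : L, Q i = ζ →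
      (fun a => (f.map φ).eval a)^[M] ((fun a => (f.map φ).eval a)^[k] ζ) =
        (fun a => (f.map φ).eval a)^[k] ζ := by
  have hmap : ∀ (L : Type) [Field L] (φ : K →+* L) m ζ,
      (f.comp^[m] X).eval₂ φ ζ = (fun a => (f.map φ).eval a)^[m] ζ := by
    intro L _ φ m ζ
    rw [← Polynomial.eval_map, Polynomial.map_iterate_comp_X, Polynomial.iterate_comp_eval,
      Polynomial.eval_X]
  obtain ⟨k, m, hm, hper⟩ := hVpre
  obtain ⟨M, hM, hkM⟩ := ((V.isZarClosed_pts _).finite_of_varDim_eq_zero hVdim).exists_iterate_add_eq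
    hm hper
  refine ⟨k, M, hM, fun L _ φ Q hQ i ζ hζ => ?_⟩
  have h := V.eval₂_eq_zero_of_geometric (G := f.comp^[k + M] X - f.comp^[k] X) ?_ hQ hζ
  · rw [Polynomial.eval₂_sub, hmap, hmap, sub_eq_zero, add_comm, Function.iterate_add_apply] at h
    exact h
  · intro x hx j z hz
    have := congrFun (hkM x hx) j
    rw [splitMap_iterate_apply, splitMap_iterate_apply, hz, polyEvalP1_iterate_coe,
      polyEvalP1_iterate_coe, OnePoint.coe_eq_coe] at this
    rw [Polynomial.aeval_def, Polynomial.eval₂_sub, hmap, hmap, this, sub_self]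

end Transfer

section ChordalMetric

variable {L : Type} [Field L] (v : AbsoluteValue L ℝ)

theorem p1Dist_coe_coe (a b : L) :
    p1Dist v (a : OnePoint L) b = v (a - b) / (max 1 (v a) * max 1 (v b)) :=
  rfl

theorem p1Dist_infty_coe (b : L) : p1Dist v ∞ (b : OnePoint L) = 1 / max 1 (v b) :=
  rfl

theorem p1Dist_self (x : OnePoint L) : p1Dist v x x = 0 := by
  induction x using OnePoint.rec with
  | infty => rfl
  | coe a => simp [p1Dist_coe_coe]

theorem p1Dist_pos {x y : OnePoint L} (h : x ≠ y) : 0 < p1Dist v x y := by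
  have hmax : ∀ a, 0 < max 1 (v a) := fun a => zero_lt_one.trans_le (le_max_left _ _)
  induction x using OnePoint.rec with
  | infty =>
    induction y using OnePoint.rec with
    | infty => exact (h rfl).elim
    | coe b => exact one_div_pos.2 (hmax b)
  | coe a =>
    induction y using OnePoint.rec with
    | infty => exact one_div_pos.2 (hmax a)
    | coe b =>
      exact div_pos (v.pos (sub_ne_zero.2 fun hab => h (by rw [hab]))) (mul_pos (hmax a) (hmax b))

theorem isOpen_p1Dist_lt (x : OnePoint L) {ε : ℝ} (hε : 0 < ε) :
    @IsOpen _ (p1Top v) {y | p1Dist v x y < ε} :=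
  TopologicalSpace.isOpen_generateFrom_of_mem ⟨x, ε, hε, rfl⟩

theorem t1Space_pnTop (ι : Type) : @T1Space (ι → OnePoint L) (pnTop ι v) := by
  let := p1Top v
  have : T1Space (OnePoint L) := t1Space_iff_exists_open.2 fun x y hxy =>
    ⟨_, isOpen_p1Dist_lt v x (p1Dist_pos v hxy),
      (p1Dist_self v x).trans_lt (p1Dist_pos v hxy), fun h => lt_irrefl (p1Dist v x y) h⟩
  exact inferInstanceAs (T1Space (ι → OnePoint L))

theorem adicClosure_eq_of_finite {ι : Type} {S : Set (ι → OnePoint L)} (hS : S.Finite) :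
    adicClosure v S = S := by
  let := pnTop (L := L) ι v
  have := t1Space_pnTop v ι
  exact hS.isClosed.closure_eq

theorem exists_p1Dist_lt_of_mem_adicClosure {ι : Type} {S : Set (ι → OnePoint L)}
    {Q : ι → OnePoint L} (hQ : Q ∈ adicClosure v S) (i : ι) {ε : ℝ} (hε : 0 < ε) :
    ∃ y ∈ S, p1Dist v (Q i) (y i) < ε := by
  let := p1Top v
  have hcont : Continuous fun y : ι → OnePoint L => y i := continuous_apply i
  obtain ⟨y, hy, hyS⟩ := mem_closure_iff.1 hQ _ ((isOpen_p1Dist_lt v (Q i) hε).preimage hcont)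
    ((p1Dist_self v (Q i)).trans_lt hε)
  exact ⟨y, hyS, hy⟩

variable {v}

/-- Points of `P^1` at chordal distance less than one from an integral point are integral, and
the chordal distance is then the usual one. -/
theorem exists_coe_of_p1Dist_lt_one (hv : IsNonarchimedean v) {x : OnePoint L} {b : L}
    (hb : v b ≤ 1) (h : p1Dist v x b < 1) : ∃ a : L, x = a ∧ v a ≤ 1 := by
  induction x using OnePoint.rec with
  | infty =>
    rw [p1Dist_infty_coe, max_eq_left hb] at h
    norm_num at h
  | coe a =>
    refine ⟨a, rfl, ?_⟩
    by_contra! ha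
    rw [p1Dist_coe_coe, max_eq_left hb, max_eq_right ha.le, mul_one, div_lt_one (by linarith)] at h
    have := hv (a - b) b
    rw [sub_add_cancel] at this
    exact absurd this (not_le.2 (max_lt h (hb.trans_lt ha)))

theorem p1Dist_coe_of_le_one {a b : L} (ha : v a ≤ 1) (hb : v b ≤ 1) :
    p1Dist v (a : OnePoint L) b = v (a - b) := by
  rw [p1Dist_coe_coe, max_eq_left ha, max_eq_left hb, mul_one, div_one]

end ChordalMetric

section Local

theorem CompletionOf.isNonarchimedean {K : Type} [Field K] {w : PlaceK K} (hw : w.IsNonarch)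
    (C : CompletionOf w) : IsNonarchimedean C.absv := by
  intro a b
  refine le_of_forall_pos_le_add fun ε hε => ?_
  obtain ⟨x, hx⟩ := C.dense a (ε / 3) (by positivity)
  obtain ⟨y, hy⟩ := C.dense b (ε / 3) (by positivity)
  have h1 := hw x y
  rw [← C.compat, ← C.compat x, ← C.compat y, map_add] at h1
  have h2 : C.absv (a + b) ≤ C.absv (C.emb x + C.emb y) + (ε / 3 + ε / 3) := by
    have h3 := C.absv.add_le (C.emb x + C.emb y) ((a - C.emb x) + (b - C.emb y))
    have h4 := C.absv.add_le (a - C.emb x) (b - C.emb y)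
    rw [show C.emb x + C.emb y + ((a - C.emb x) + (b - C.emb y)) = a + b by ring] at h3
    linarith
  have h5 : ∀ c z, C.absv (c - C.emb z) < ε / 3 → C.absv (C.emb z) ≤ C.absv c + ε / 3 := by
    intro c z hz
    have := C.absv.add_le c (C.emb z - c)
    rw [add_sub_cancel, C.absv.map_sub] at this
    linarith
  have h6 := h1.trans (max_le_max (h5 a x hx) (h5 b y hy))
  rw [max_add_add_right] at h6
  linarith

theorem finite_range_iterate {α : Type*} {g : α → α} {x : α} {j M : ℕ} (hM : 0 < M)
    (h : g^[M] (g^[j] x) = g^[j] x) : (Set.range fun t => g^[t] x).Finite := by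
  refine ((Set.finite_Iio (j + M)).image fun t => g^[t] x).subset ?_
  rintro _ ⟨t, rfl⟩
  induction t using Nat.strong_induction_on with
  | _ t ih =>
    rcases lt_or_ge t (j + M) with ht | ht
    · exact ⟨t, ht, rfl⟩
    · obtain ⟨s, rfl⟩ := Nat.exists_eq_add_of_le ht
      have := ih (s + j) (by omega)
      rw [show j + M + s = s + (M + j) by ring]
      simp only [Function.iterate_add_apply] at this ⊢
      rwa [h]

theorem finite_fwdOrbit_splitMap {L ι : Type} [CommRing L] [Finite ι] {p : L[X]}
    {x : ι → OnePoint L} {M : ℕ} (hM : 0 < M)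
    (h : ∀ i, ∃ j, (polyEvalP1 p)^[M] ((polyEvalP1 p)^[j] (x i)) = (polyEvalP1 p)^[j] (x i)) :
    (fwdOrbit (splitMap p) x).Finite := by
  refine (Set.Finite.pi' fun i => finite_range_iterate hM (h i).choose_spec).subset ?_
  rintro _ ⟨t, rfl⟩ i
  exact ⟨t, (splitMap_iterate_apply p t x i).symm⟩

variable {L : Type} [Field L] {v : AbsoluteValue L ℝ}

/-- At a place of good reduction where the multipliers of the relevant periodic points are units, an
integral point whose orbit accumulates at a preperiodic point is itself preperiodic. -/
theorem AbsoluteValue.exists_iterate_eq_of_accumulation (hv : IsNonarchimedean v) {p : L[X]}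
    (hp : ∀ m, v (p.coeff m) ≤ 1) {M k : ℕ} (hM : 0 < M) {x ζ : L} (hx : v x ≤ 1) (hζ : v ζ ≤ 1)
    (hper : (fun a => p.eval a)^[M] ((fun a => p.eval a)^[k] ζ) = (fun a => p.eval a)^[k] ζ)
    (hcl : ∀ ε > 0, ∃ j, v ((fun a => p.eval a)^[j] x - ζ) < ε)
    {Ψ A B : L[X]} (hB : ∀ m, v (B.coeff m) ≤ 1)
    (hAB : A * Ψ + B * (p.comp^[M] X).derivative = 1)
    (hΨ : p.comp^[M] X - X = Ψ ∨ ∃ a c : L, v a = 1 ∧ (x ≠ c → v (x - c) = 1) ∧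
      (∃ d, d ≠ 0 ∧ p = C a * (X - C c) ^ d + C c) ∧ p.comp^[M] X - X = (X - C c) * Ψ) :
    ∃ j, (fun a => p.eval a)^[M] ((fun a => p.eval a)^[j] x) = (fun a => p.eval a)^[j] x := by
  set g : L → L := fun a => p.eval a with hg
  set η := g^[k] ζ
  have hη : v η ≤ 1 := AbsoluteValue.iterate_eval_le_one hv hp hζ k
  have hcl' : ∀ ε > 0, ∃ j, v (g^[j] x - η) < ε := fun ε hε => by
    obtain ⟨j, hj⟩ := hcl ε hε
    refine ⟨k + j, ?_⟩
    rw [Function.iterate_add_apply]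
    exact (AbsoluteValue.iterate_eval_sub_le hv hp
      (AbsoluteValue.iterate_eval_le_one hv hp hx j) hζ k).trans_lt hj
  have hroot : (p.comp^[M] X - X).eval η = 0 := by
    rw [Polynomial.eval_sub, Polynomial.iterate_comp_eval, Polynomial.eval_X]
    exact sub_eq_zero.2 hper
  have hunit : Ψ.eval η = 0 → ∃ j, g^[M] (g^[j] x) = g^[j] x := by
    intro h0
    have h1 := congrArg (Polynomial.eval η) hAB
    rw [Polynomial.eval_add, Polynomial.eval_mul, Polynomial.eval_mul, h0, mul_zero, zero_add,
      Polynomial.eval_one] at h1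
    have h2 : v (B.eval η) ≤ 1 := AbsoluteValue.eval_le_one hv hB hη
    have h3 : v ((p.comp^[M] X).derivative.eval η) ≤ 1 := by
      refine AbsoluteValue.eval_le_one hv (fun m => ?_) hη
      rw [Polynomial.coeff_derivative, map_mul, ← Nat.cast_succ]
      exact mul_le_one₀ (AbsoluteValue.coeff_iterate_comp_le_one hv hp M _) (v.nonneg _)
        (hv.apply_natCast_le_one)
    have h4 : v ((p.comp^[M] X).derivative.eval η) = 1 := by
      have := congrArg v h1
      rw [map_mul, map_one] at this
      exact le_antisymm h3 (this ▸ mul_le_of_le_one_left (v.nonneg _) h2)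
    obtain ⟨j, hj⟩ := AbsoluteValue.exists_iterate_eq_of_unit_multiplier hv hp hM hη hper h4 hcl'
    exact ⟨j, by rw [← hg] at hj; rw [hj, hper]⟩
  rcases hΨ with hΨ | ⟨a, c, ha, hxc, ⟨d, hd, hpac⟩, hΨ⟩
  · exact hunit (hΨ ▸ hroot)
  · rw [hΨ, Polynomial.eval_mul, mul_eq_zero] at hroot
    refine hroot.elim (fun hηc => ?_) hunit
    have hgc : ∀ y, g y = a * (y - c) ^ d + c := fun y => by simp [hg, hpac]
    by_cases hx' : x = c
    · refine ⟨0, Function.iterate_fixed ?_ M⟩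
      rw [Function.iterate_zero_apply, hx', hgc, sub_self, zero_pow hd, mul_zero, zero_add]
    · have hconst : ∀ j, v (g^[j] x - c) = 1 := fun j => by
        induction j with
        | zero => exact hxc hx'
        | succ j ih =>
          rw [Function.iterate_succ_apply', hgc, add_sub_cancel_right, map_mul, map_pow, ih, ha,
            one_pow, one_mul]
      obtain ⟨j, hj⟩ := hcl' 1 one_pos
      rw [Polynomial.eval_sub, Polynomial.eval_X, Polynomial.eval_C, sub_eq_zero] at hηc
      rw [hηc, hconst] at hj
      exact (lt_irrefl _ hj).elim

end Local

section BaseChange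

variable {K L ι : Type} [Field K] [Field L] (φ : K →+* L)

theorem mapPoint_polyEvalP1 (f : K[X]) (x : OnePoint K) :
    mapPoint φ (polyEvalP1 f x) = polyEvalP1 (f.map φ) (mapPoint φ x) := by
  induction x using OnePoint.rec with
  | infty => rfl
  | coe a => exact congrArg OnePoint.some (Polynomial.eval_map_apply φ a).symm

theorem mapPoint_splitMap_iterate (f : K[X]) (t : ℕ) (x : ι → OnePoint K) :
    (fun i => mapPoint φ ((splitMap f)^[t] x i)) =
      (splitMap (f.map φ))^[t] fun i => mapPoint φ (x i) := by
  induction t generalizing x with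
  | zero => rfl
  | succ t ih =>
    rw [Function.iterate_succ_apply, ih, Function.iterate_succ_apply]
    congr 1
    exact funext fun i => mapPoint_polyEvalP1 φ f (x i)

theorem homCoords_mapPoint (x : OnePoint K) (e : Fin 2) :
    homCoords (mapPoint φ x) e = φ (homCoords x e) := by
  induction x using OnePoint.rec <;> fin_cases e <;> simp [mapPoint]

theorem ClosedSubvar.mem_pts_of_mapPoint [DecidableEq ι] (V : ClosedSubvar K ι) {x : ι → OnePoint K}
    (hx : (fun i => mapPoint φ (x i)) ∈ V.pts φ) : x ∈ V.pts (RingHom.id K) := by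
  intro p hp
  have h := hx p hp
  simp only [vanishesAt, homCoords_mapPoint, MvPolynomial.eval_map] at h
  rw [vanishesAt, MvPolynomial.map_id]
  apply φ.injective
  rw [map_zero, ← h, MvPolynomial.eval, MvPolynomial.coe_eval₂Hom, MvPolynomial.hom_eval₂,
    RingHom.comp_id]

end BaseChange

/-- The conclusion of the main theorem at a single place satisfying finitely many integrality
conditions. -/
theorem orbitClosureAvoids_of_integral {K : Type} [Field K] {n : ℕ} {w : PlaceK K}
    (hw : w.IsNonarch) {f : K[X]} {V : ClosedSubvar K (Fin n)} {P : Fin n → OnePoint K}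
    (hP : fwdOrbit (splitMap f) P ∩ V.pts (RingHom.id K) = ∅) {k M : ℕ} (hM : 0 < M)
    (hper : ∀ (L : Type) [Field L] (φ : K →+* L), ∀ Q ∈ V.pts φ, ∀ i, ∀ ζ : L, Q i = ζ →
      (fun a => (f.map φ).eval a)^[M] ((fun a => (f.map φ).eval a)^[k] ζ) =
        (fun a => (f.map φ).eval a)^[k] ζ)
    {Ψ A B : K[X]} (hAB : A * Ψ + B * (f.comp^[M] X).derivative = 1)
    (hf : ∀ m, w.v (f.coeff m) ≤ 1) (hB : ∀ m, w.v (B.coeff m) ≤ 1)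
    (hx : ∀ i, ∀ x : K, P i = x → w.v x ≤ 1)
    (hΨ : f.comp^[M] X - X = Ψ ∨ ∃ a c : K, w.v a = 1 ∧
      (∀ i, ∀ x : K, P i = x → x ≠ c → w.v (x - c) = 1) ∧
      (∃ d, d ≠ 0 ∧ f = C a * (X - C c) ^ d + C c) ∧ f.comp^[M] X - X = (X - C c) * Ψ) :
    OrbitClosureAvoids w f P V := by
  intro C
  set φ := C.emb
  have hv := C.isNonarchimedean hw
  rw [Set.eq_empty_iff_forall_notMem]
  rintro Q ⟨hQcl, hQV⟩
  have hp : ∀ m, C.absv ((f.map φ).coeff m) ≤ 1 := fun m => by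
    rw [Polynomial.coeff_map, C.compat]
    exact hf m
  have hfin : (fwdOrbit (splitMap (f.map φ)) fun i => mapPoint φ (P i)).Finite := by
    refine finite_fwdOrbit_splitMap hM fun i => ?_
    cases hPi : P i using OnePoint.rec with
    | infty => exact ⟨0, polyEvalP1_iterate_infty _ M⟩
    | coe x =>
      change ∃ j, (polyEvalP1 (f.map φ))^[M] ((polyEvalP1 (f.map φ))^[j] (φ x : OnePoint C.carrier))
        = (polyEvalP1 (f.map φ))^[j] (φ x : OnePoint C.carrier)
      simp only [polyEvalP1_iterate_coe, OnePoint.coe_eq_coe]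
      have hφx : C.absv (φ x) ≤ 1 := (C.compat x).trans_le (hx i x hPi)
      have hit := AbsoluteValue.iterate_eval_le_one hv hp hφx
      have hdist : ∀ ε > 0, ∃ j, p1Dist C.absv (Q i)
          ((fun a => (f.map φ).eval a)^[j] (φ x) : C.carrier) < ε := by
        intro ε hε
        obtain ⟨_, ⟨j, rfl⟩, hj⟩ := exists_p1Dist_lt_of_mem_adicClosure C.absv hQcl i hε
        refine ⟨j, ?_⟩
        change p1Dist C.absv (Q i) ((splitMap (f.map φ))^[j] (fun i => mapPoint φ (P i)) i) < ε at hj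
        rw [splitMap_iterate_apply] at hj
        rw [hPi] at hj
        rw [← polyEvalP1_iterate_coe]
        exact hj
      obtain ⟨j, hj⟩ := hdist 1 one_pos
      obtain ⟨ζ, hζQ, hζ⟩ := exists_coe_of_p1Dist_lt_one hv (hit j) hj
      refine AbsoluteValue.exists_iterate_eq_of_accumulation hv hp hM hφx hζ
        (hper _ φ Q hQV i ζ hζQ) (fun ε hε => ?_) (Ψ := Ψ.map φ) (A := A.map φ) (B := B.map φ)
        (fun m => ?_) ?_ ?_
      · obtain ⟨j, hj⟩ := hdist ε hε
        refine ⟨j, ?_⟩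
        rwa [hζQ, p1Dist_coe_of_le_one hζ (hit j), C.absv.map_sub] at hj
      · rw [Polynomial.coeff_map, C.compat]
        exact hB m
      · rw [← Polynomial.map_iterate_comp_X, Polynomial.derivative_map]
        simpa using congrArg (Polynomial.map φ) hAB
      · rw [← Polynomial.map_iterate_comp_X]
        refine hΨ.imp (fun h => by rw [← h]; simp) ?_
        rintro ⟨a, c, ha, hc, ⟨d, hd, hfd⟩, h⟩
        refine ⟨φ a, φ c, (C.compat a).trans ha, fun hne => ?_, ⟨d, hd, ?_⟩, ?_⟩
        · rw [← map_sub, C.compat]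
          exact hc i x hPi fun h => hne (by rw [h])
        · have := congrArg (Polynomial.map φ) hfd
          simpa using this
        · have := congrArg (Polynomial.map φ) h
          simpa using this
  rw [adicClosure_eq_of_finite _ hfin] at hQcl
  obtain ⟨t, rfl⟩ := hQcl
  change (splitMap (f.map φ))^[t] (fun i => mapPoint φ (P i)) ∈ V.pts φ at hQV
  rw [← mapPoint_splitMap_iterate] at hQV
  exact Set.eq_empty_iff_forall_notMem.1 hP _ ⟨⟨t, rfl⟩, V.mem_pts_of_mapPoint φ hQV⟩

/-- **Dynamical Hasse principle for special polynomials and zero-dimensional preperiodic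
subvarieties, at almost all places** (Theorem 3.5(c)).

Let `K` be a number field or a function field of characteristic 0, `n ≥ 2`, `f ∈ K[X]` a
special polynomial of degree at least 2, and `φ = (f,…,f)`. Let `V` be a zero-dimensional
`φ`-preperiodic closed subvariety of `(P^1_K)^n`. Then for every `P ∈ (P^1)^n(K)` whose
`φ`-orbit does not meet `V(K)`, for all but finitely many non-archimedean places `𝔭` of
`K`, `V(K_𝔭)` does not meet the `𝔭`-adic closure of the orbit. -/
theorem dynamical_hasse_principle_special_zero_dimensional
    (K : Type) [Field K] (κ : Subfield K)
    (hK : NumberFieldOrFunctionFieldOver K κ)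
    (n : ℕ) (hn : 2 ≤ n)
    (f : Polynomial K) (hf : 2 ≤ f.natDegree) (hsp : IsSpecialPoly f)
    (V : ClosedSubvar K (Fin n))
    (hVdim : varDim (V.pts (algebraMap K (AlgebraicClosure K))) = ((0 : ℕ∞) : WithBot ℕ∞))
    (hVpre : SubvarPreperiodic (f.map (algebraMap K (AlgebraicClosure K)))
      (V.pts (algebraMap K (AlgebraicClosure K))))
    (P : Fin n → OnePoint K)
    (hP : fwdOrbit (splitMap f) P ∩ V.pts (RingHom.id K) = ∅) :
    AllButFinitelyManyPlaces K κ fun w => OrbitClosureAvoids w f P V := by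
  have := hK.charZero
  obtain ⟨k, M, hM, hper⟩ := V.exists_iterate_add_eq f hVdim hVpre
  obtain ⟨Ψ, ⟨A, B, hAB⟩, hΨ⟩ := hsp.exists_isCoprime_derivative hf hM
  have hcoord : ∀ R : K → PlaceK K → Prop, (∀ x, AllButFinitelyManyPlaces K κ (R x)) →
      AllButFinitelyManyPlaces K κ fun w => ∀ i, ∀ x : K, P i = x → R x w := fun R hR => by
    refine (AllButFinitelyManyPlaces.forall_finset (Q := fun i w => ∀ x : K, P i = x → R x w)
      Finset.univ fun i _ => ?_).mono fun w _ h i => h i (Finset.mem_univ i)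
    cases hPi : P i using OnePoint.rec with
    | infty => exact .of_forall fun w x hx => (OnePoint.infty_ne_coe x hx).elim
    | coe y => exact (hR y).mono fun w _ h x hx => OnePoint.coe_injective hx ▸ h
  have hΨw : AllButFinitelyManyPlaces K κ fun w => f.comp^[M] X - X = Ψ ∨ ∃ a c : K, w.v a = 1 ∧
      (∀ i, ∀ x : K, P i = x → x ≠ c → w.v (x - c) = 1) ∧
      (∃ d, d ≠ 0 ∧ f = C a * (X - C c) ^ d + C c) ∧ f.comp^[M] X - X = (X - C c) * Ψ := by
    rcases hΨ with h | ⟨a, c, ha, hfac, h⟩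
    · exact .of_forall fun w => Or.inl h
    · refine ((AllButFinitelyManyPlaces.eq_one hK ha).and
        (hcoord (fun x w => x ≠ c → w.v (x - c) = 1) fun x => ?_)).mono
        fun w _ hw => Or.inr ⟨a, c, hw.1, hw.2, ⟨_, by omega, hfac⟩, h⟩
      by_cases hx : x = c
      · exact .of_forall fun w h => (h hx).elim
      · exact (AllButFinitelyManyPlaces.eq_one hK (sub_ne_zero.2 hx)).mono fun w _ h _ => h
  refine ((((AllButFinitelyManyPlaces.coeff_le_one hK f).and
    (AllButFinitelyManyPlaces.coeff_le_one hK B)).and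
    (hcoord (fun x w => w.v x ≤ 1) fun x => .le_one hK x)).and hΨw).mono fun w hw h => ?_
  exact orbitClosureAvoids_of_integral hw hP hM hper hAB h.1.1.1 h.1.1.2 h.1.2 h.2
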